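/- Let 1 ≤ p < ∞ and n ≥ 1. There exists a constant C_7 = C_7(n,p) > 0 with the following property. Let U ⊂ ℝ^{2n} be a nonempty open, bounded, connected set and let u ∈ W^{1,∞}(U,ℝ^{2n}) be essentially injective with diam(u(U)) ≤ d and 0 < λ ≤ det Du(x) ≤ Λ for a.e. x ∈ U. Then there exists a bounded Lipschitz map S : U → ℝ^{2n}, essentially injective, with DS(x)ᵀ J DS(x) = J for a.e. x ∈ U, such that ∫_U |u(x) − S(x)|^p dx ≤ C_7 (1 + (1+Λ)^{2n−1} (d/λ^{1/n})^p (1 + λ^{−p}(Λ/λ)^{2p−2})) · ∫_U |Du(x)ᵀ J Du(x) − J|^p dx. -/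

import Mathlib

open MeasureTheory Metric Set Bornology Matrix

noncomputable section

/-- Frobenius norm of a real square matrix. -/
def frob {ι : Type*} [Fintype ι] (A : Matrix ι ι ℝ) : ℝ :=
  Real.sqrt (∑ i, ∑ j, (A i j) ^ 2)

/-- The matrix of the derivative `Du(x)` in the standard basis of `ℝ^{2n}`
(junk value if `u` is not differentiable at `x`). -/
def matD {n : ℕ} (u : EuclideanSpace ℝ (Fin n ⊕ Fin n) → EuclideanSpace ℝ (Fin n ⊕ Fin n))
    (x : EuclideanSpace ℝ (Fin n ⊕ Fin n)) : Matrix (Fin n ⊕ Fin n) (Fin n ⊕ Fin n) ℝ :=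
  LinearMap.toMatrix (EuclideanSpace.basisFun (Fin n ⊕ Fin n) ℝ).toBasis
    (EuclideanSpace.basisFun (Fin n ⊕ Fin n) ℝ).toBasis ((fderiv ℝ u x).toLinearMap)

/-- The multiplicity `mult_U(u)`: essential supremum of the counting function
`y ↦ #(U ∩ u⁻¹{y})`. -/
def multOn {n : ℕ} (U : Set (EuclideanSpace ℝ (Fin n ⊕ Fin n)))
    (u : EuclideanSpace ℝ (Fin n ⊕ Fin n) → EuclideanSpace ℝ (Fin n ⊕ Fin n)) : ℕ∞ :=
  essSup (fun y => (U ∩ u ⁻¹' {y}).encard) volume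

/-- Phase space. -/
abbrev EE (n : ℕ) := EuclideanSpace ℝ (Fin n ⊕ Fin n)

theorem matD_of_hasFDerivAt {n : ℕ} {u : EE n → EE n} {x : EE n} {L : EE n →L[ℝ] EE n}
    (h : HasFDerivAt u L x) (i j : Fin n ⊕ Fin n) :
    matD u x i j = (L (EuclideanSpace.single j 1)) i := by
  simp [matD, h.fderiv, LinearMap.toMatrix_apply]

theorem matD_comp {n : ℕ} {f g : EE n → EE n} {x : EE n}
    (hf : DifferentiableAt ℝ f (g x)) (hg : DifferentiableAt ℝ g x) :
    matD (f ∘ g) x = matD f (g x) * matD g x := by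
  unfold matD
  rw [fderiv_comp x hf hg, ← LinearMap.toMatrix_comp]
  rfl

theorem matD_det {n : ℕ} (u : EE n → EE n) (x : EE n) :
    (matD u x).det = (fderiv ℝ u x).det := by
  unfold matD
  rw [LinearMap.det_toMatrix]

/-- Smooth symplectic maps. -/
def Nice {n : ℕ} (S : EE n → EE n) : Prop :=
  ContDiff ℝ 1 S ∧ ∀ x, (matD S x)ᵀ * Matrix.J (Fin n) ℝ * matD S x = Matrix.J (Fin n) ℝ

theorem Nice.comp {n : ℕ} {S T : EE n → EE n} (hS : Nice S) (hT : Nice T) : Nice (S ∘ T) := by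
  refine ⟨hS.1.comp hT.1, fun x => ?_⟩
  rw [matD_comp ((hS.1.differentiable (by norm_num)) _) ((hT.1.differentiable (by norm_num)) _)]
  have h1 := hS.2 (T x)
  have h2 := hT.2 x
  calc (matD S (T x) * matD T x)ᵀ * Matrix.J (Fin n) ℝ * (matD S (T x) * matD T x)
      = (matD T x)ᵀ * ((matD S (T x))ᵀ * Matrix.J (Fin n) ℝ * matD S (T x)) * matD T x := by
        simp only [Matrix.transpose_mul, Matrix.mul_assoc]
    _ = _ := by rw [h1, h2]

/-- A symplectic diffeomorphism with inverse and displacement bounded by `M`. -/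
def NicePair {n : ℕ} (M : ℝ) (S S' : EE n → EE n) : Prop :=
  Nice S ∧ Nice S' ∧ (∀ x, S' (S x) = x) ∧ (∀ x, S (S' x) = x) ∧ ∀ x, ‖S x - x‖ ≤ M

theorem NicePair.symm {n : ℕ} {M : ℝ} {S S' : EE n → EE n} (h : NicePair M S S') :
    NicePair M S' S := by
  refine ⟨h.2.1, h.1, h.2.2.2.1, h.2.2.1, fun x => ?_⟩
  have := h.2.2.2.2 (S' x)
  rw [h.2.2.2.1, norm_sub_rev] at this
  exact this

theorem NicePair.comp {n : ℕ} {M N : ℝ} {S S' T T' : EE n → EE n} (h : NicePair M S S')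
    (h' : NicePair N T T') : NicePair (M + N) (S ∘ T) (T' ∘ S') := by
  refine ⟨h.1.comp h'.1, h'.2.1.comp h.2.1, fun x => ?_, fun x => ?_, fun x => ?_⟩
  · simp [h.2.2.1, h'.2.2.1]
  · simp [h.2.2.2.1, h'.2.2.2.1]
  · have h1 := h.2.2.2.2 (T x)
    have h2 := h'.2.2.2.2 x
    calc ‖(S ∘ T) x - x‖ = ‖(S (T x) - T x) + (T x - x)‖ := by simp
      _ ≤ _ := (norm_add_le _ _).trans (add_le_add h1 h2)

/-- The vector `J w`. -/
def Jv {n : ℕ} (w : EE n) : EE n := WithLp.toLp 2 (Matrix.J (Fin n) ℝ *ᵥ w.ofLp)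

theorem Jv_inl {n : ℕ} (w : EE n) (i : Fin n) : Jv w (Sum.inl i) = - w (Sum.inr i) := by
  simp [Jv, Matrix.J, Matrix.fromBlocks_mulVec, Matrix.neg_mulVec]

theorem Jv_inr {n : ℕ} (w : EE n) (i : Fin n) : Jv w (Sum.inr i) = w (Sum.inl i) := by
  simp [Jv, Matrix.J, Matrix.fromBlocks_mulVec]

/-- The functional `w · z`. -/
def dotw {n : ℕ} (w : EE n) : EE n →L[ℝ] ℝ := innerSL ℝ w

theorem dotw_apply {n : ℕ} (w z : EE n) : dotw w z = ∑ j, w j * z j := by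
  simp [dotw, PiLp.inner_apply, mul_comm]

theorem dotw_Jv {n : ℕ} (w : EE n) : dotw w (Jv w) = 0 := by
  simp [dotw_apply, Fintype.sum_sum_type, Jv_inl, Jv_inr, mul_comm]

/-- Symplectic shear in the direction `J w`. -/
def shear {n : ℕ} (a : ℝ → ℝ) (w : EE n) (z : EE n) : EE n := z + a (dotw w z) • Jv w

theorem shear_hasFDerivAt {n : ℕ} {a : ℝ → ℝ} (ha : ContDiff ℝ 1 a) (w z : EE n) :
    HasFDerivAt (shear a w)
      (ContinuousLinearMap.id ℝ (EE n) + (deriv a (dotw w z) • dotw w).smulRight (Jv w)) z := by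
  have h1 : HasDerivAt a (deriv a (dotw w z)) (dotw w z) :=
    ((ha.differentiable (by norm_num)) _).hasDerivAt
  exact (hasFDerivAt_id z).add ((h1.comp_hasFDerivAt z (dotw w).hasFDerivAt).smul_const (Jv w))

theorem shear_nice {n : ℕ} {a : ℝ → ℝ} (ha : ContDiff ℝ 1 a) (w : EE n) : Nice (shear a w) := by
  refine ⟨?_, fun z => ?_⟩
  · unfold shear
    exact contDiff_id.add ((ha.comp (dotw w).contDiff).smul contDiff_const)
  · have hM : matD (shear a w) z = 1 + (deriv a (dotw w z)) •
        Matrix.vecMulVec (Matrix.J (Fin n) ℝ *ᵥ w.ofLp) w.ofLp := by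
      ext i j
      rw [matD_of_hasFDerivAt (shear_hasFDerivAt ha w z)]
      simp [Matrix.vecMulVec_apply, Matrix.one_apply, dotw_apply, Jv, PiLp.single_apply]
      ring
    have hJ2 := Matrix.J_squared (Fin n) ℝ
    have hJt := Matrix.J_transpose (Fin n) ℝ
    have h0 : w.ofLp ⬝ᵥ (Matrix.J (Fin n) ℝ *ᵥ w.ofLp) = 0 := by
      have := dotw_Jv w
      rw [dotw_apply] at this
      exact this
    set J := Matrix.J (Fin n) ℝ
    set v := w.ofLp
    set b := deriv a (dotw w z)
    rw [hM]
    have e1 : J * Matrix.vecMulVec (J *ᵥ v) v = - Matrix.vecMulVec v v := by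
      rw [Matrix.mul_vecMulVec, Matrix.mulVec_mulVec, hJ2]
      simp [Matrix.neg_mulVec, Matrix.neg_vecMulVec]
    have e2 : Matrix.vecMulVec v (J *ᵥ v) * J = Matrix.vecMulVec v v := by
      rw [Matrix.vecMulVec_mul]
      congr 1
      rw [← Matrix.mulVec_transpose, hJt, Matrix.neg_mulVec, Matrix.mulVec_mulVec, hJ2]
      simp [Matrix.neg_mulVec]
    have e3 : Matrix.vecMulVec v v * Matrix.vecMulVec (J *ᵥ v) v = 0 := by
      rw [Matrix.vecMulVec_mul_vecMulVec, h0]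
      simp
    simp only [Matrix.transpose_add, Matrix.transpose_one, Matrix.transpose_smul,
      Matrix.transpose_vecMulVec, Matrix.add_mul, Matrix.mul_add, Matrix.one_mul, Matrix.mul_one,
      Matrix.smul_mul, Matrix.mul_smul, e1, e2, e3]
    simp

theorem shear_nicePair {n : ℕ} {a : ℝ → ℝ} (ha : ContDiff ℝ 1 a) (w : EE n) {M : ℝ}
    (hM : ∀ s, |a s| ≤ M) : NicePair (M * ‖Jv w‖) (shear a w) (shear (fun s => - a s) w) := by
  refine ⟨shear_nice ha w, shear_nice ha.neg w, fun x => ?_, fun x => ?_, fun x => ?_⟩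
  · simp [shear, dotw_Jv]
  · simp [shear, dotw_Jv]
  · simp only [shear, add_sub_cancel_left, norm_smul, Real.norm_eq_abs]
    gcongr
    exact hM _

/-- The shrunk unit tile with corner `c`. -/
def tile {n : ℕ} (δ : ℝ) (c : EE n) : Set (EE n) := {x | ∀ j, c j + δ ≤ x j ∧ x j ≤ c j + 1 - δ}

/-- Tiles at `c` can be moved to tiles at `c'` by bounded symplectic maps. -/
def Reach {n : ℕ} {κ : Type*} (c c' : κ → EE n) : Prop :=
  ∃ M : ℝ, ∀ δ : ℝ, 0 < δ → ∃ S S' : EE n → EE n, NicePair M S S' ∧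
    ∀ k, ∀ x ∈ tile δ (c k), S x = x + (c' k - c k)

theorem tile_shift {n : ℕ} {δ : ℝ} {c c' x : EE n} (h : x ∈ tile δ c) :
    x + (c' - c) ∈ tile δ c' := by
  intro j
  have := h j
  simp only [PiLp.add_apply, PiLp.sub_apply]
  constructor <;> linarith [this.1, this.2]

theorem Reach.trans {n : ℕ} {κ : Type*} {c c' c'' : κ → EE n} (h : Reach c c')
    (h' : Reach c' c'') : Reach c c'' := by
  obtain ⟨M, hM⟩ := h
  obtain ⟨N, hN⟩ := h'
  refine ⟨N + M, fun δ hδ => ?_⟩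
  obtain ⟨S, S', hS, hS2⟩ := hM δ hδ
  obtain ⟨T, T', hT, hT2⟩ := hN δ hδ
  refine ⟨T ∘ S, S' ∘ T', hT.comp hS, fun k x hx => ?_⟩
  simp only [Function.comp]
  rw [hS2 k x hx, hT2 k _ (tile_shift hx)]
  abel

theorem Reach.symm {n : ℕ} {κ : Type*} {c c' : κ → EE n} (h : Reach c c') : Reach c' c := by
  obtain ⟨M, hM⟩ := h
  refine ⟨M, fun δ hδ => ?_⟩
  obtain ⟨S, S', hS, hS2⟩ := hM δ hδ
  refine ⟨S', S, hS.symm, fun k x hx => ?_⟩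
  have := hS2 k _ (tile_shift (c' := c k) hx)
  have h3 : x + (c k - c' k) + (c' k - c k) = x := by abel
  rw [h3] at this
  rw [← this, hS.2.2.1, this]

theorem nicePair_id {n : ℕ} : NicePair (n := n) 0 id id := by
  have : Nice (n := n) id := by
    refine ⟨contDiff_id, fun x => ?_⟩
    have : matD (n := n) id x = 1 := by
      ext i j
      rw [matD_of_hasFDerivAt (hasFDerivAt_id x)]
      simp [Matrix.one_apply, PiLp.single_apply]
    rw [this]
    simp
  exact ⟨this, this, fun _ => rfl, fun _ => rfl, fun x => by simp⟩

theorem Reach.refl {n : ℕ} {κ : Type*} (c : κ → EE n) : Reach c c :=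
  ⟨0, fun _ _ => ⟨id, id, nicePair_id, fun k x _ => by simp⟩⟩

theorem exists_step {κ : Type*} [Fintype κ] (lo hi t : κ → ℝ)
    (h : ∀ k l, t k ≠ t l → Disjoint (Icc (lo k) (hi k)) (Icc (lo l) (hi l))) :
    ∃ a : ℝ → ℝ, ContDiff ℝ 1 a ∧ (∀ s, |a s| ≤ ∑ k, |t k|) ∧
      ∀ k, ∀ s ∈ Icc (lo k) (hi k), a s = t k := by
  classical
  have key : ∀ v : ℝ, ∃ χ : ℝ → ℝ, ContDiff ℝ 1 χ ∧ (∀ s, χ s ∈ Icc (0 : ℝ) 1) ∧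
      (∀ k, t k ≠ v → ∀ s ∈ Icc (lo k) (hi k), χ s = 0) ∧
      (∀ k, t k = v → ∀ s ∈ Icc (lo k) (hi k), χ s = 1) := by
    intro v
    have hc1 : IsClosed (⋃ k ∈ {k | t k ≠ v}, Icc (lo k) (hi k)) :=
      (Set.toFinite _).isClosed_biUnion fun k _ => isClosed_Icc
    have hc2 : IsClosed (⋃ k ∈ {k | t k = v}, Icc (lo k) (hi k)) :=
      (Set.toFinite _).isClosed_biUnion fun k _ => isClosed_Icc
    obtain ⟨f, h0, h1, h2⟩ := exists_contMDiffMap_zero_one_of_isClosed (n := 1)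
      (modelWithCornersSelf ℝ ℝ) hc1 hc2 (by
        simp only [Set.disjoint_iUnion_left, Set.disjoint_iUnion_right]
        intro k hk l hl
        apply h
        simp only [mem_ofPred_eq] at hk hl
        intro e; exact hl (e ▸ hk) )
    refine ⟨f, f.contMDiff.contDiff, h2, fun k hk s hs => ?_, fun k hk s hs => ?_⟩
    · exact h0 (mem_biUnion (s := {k | t k ≠ v}) hk hs)
    · exact h1 (mem_biUnion (s := {k | t k = v}) hk hs)
  choose χ hχ1 hχ2 hχ3 hχ4 using key
  refine ⟨fun s => ∑ v ∈ Finset.univ.image t, v * χ v s, ?_, fun s => ?_, fun k s hs => ?_⟩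
  · exact ContDiff.sum fun v _ => contDiff_const.mul (hχ1 v)
  · calc |∑ v ∈ Finset.univ.image t, v * χ v s| ≤ ∑ v ∈ Finset.univ.image t, |v * χ v s| :=
        Finset.abs_sum_le_sum_abs _ _
      _ ≤ ∑ v ∈ Finset.univ.image t, |v| := by
        refine Finset.sum_le_sum fun v _ => ?_
        rw [abs_mul, abs_of_nonneg (hχ2 v s).1]
        exact mul_le_of_le_one_right (abs_nonneg _) (hχ2 v s).2
      _ ≤ ∑ k, |t k| := Finset.sum_image_le_of_nonneg (f := fun v => |v|) (by intros; positivity)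
  · show ∑ v ∈ Finset.univ.image t, v * χ v s = t k
    rw [Finset.sum_eq_single (t k)]
    · rw [hχ4 (t k) k rfl s hs, mul_one]
    · intro v _ hv
      rw [hχ3 v k (Ne.symm hv) s hs, mul_zero]
    · intro hk
      exact absurd (Finset.mem_image_of_mem t (Finset.mem_univ k)) hk

theorem reach_move {n : ℕ} {κ : Type*} [Fintype κ] (c : κ → EE n) (w : EE n) (t : κ → ℝ)
    (hw : ∀ j, 0 ≤ w j) (hW : 0 < ∑ j, w j)
    (h : ∀ k l, t k = t l ∨ ∑ j, w j ≤ |dotw w (c k) - dotw w (c l)|) :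
    Reach c (fun k => c k + t k • Jv w) := by
  refine ⟨(∑ k, |t k|) * ‖Jv w‖, fun δ hδ => ?_⟩
  set W := ∑ j, w j with hWd
  obtain ⟨a, ha1, ha2, ha3⟩ := exists_step (fun k => dotw w (c k) + δ * W)
    (fun k => dotw w (c k) + (1 - δ) * W) t (by
      intro k l hkl
      rw [Set.disjoint_left]
      intro s hs hs'
      rcases h k l with h1 | h1
      · exact hkl h1
      · have : 0 < δ * W := by positivity
        simp only [mem_Icc] at hs hs'
        rcases le_abs.1 h1 with h2 | h2 <;> nlinarith)
  refine ⟨_, _, shear_nicePair ha1 w ha2, fun k x hx => ?_⟩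
  simp only [shear, add_sub_cancel_left]
  rw [ha3 k]
  rw [dotw_apply, dotw_apply, hWd, Finset.mul_sum, Finset.mul_sum, ← Finset.sum_add_distrib,
    ← Finset.sum_add_distrib]
  constructor
  · gcongr with j _
    nlinarith [hw j, (hx j).1]
  · gcongr with j _
    nlinarith [hw j, (hx j).2]

theorem EE_ext {n : ℕ} {x y : EE n} (h1 : ∀ i, x (Sum.inl i) = y (Sum.inl i))
    (h2 : ∀ i, x (Sum.inr i) = y (Sum.inr i)) : x = y := by
  ext j
  rcases j with i | i
  · exact h1 i
  · exact h2 i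

theorem dotw_single {n : ℕ} (j : Fin n ⊕ Fin n) (z : EE n) :
    dotw (EuclideanSpace.single j 1) z = z j := by
  simp [dotw_apply, PiLp.single_apply]

theorem sum_single_one {n : ℕ} (j : Fin n ⊕ Fin n) :
    ∑ l, (EuclideanSpace.single j (1 : ℝ) : EE n) l = 1 := by
  simp [PiLp.single_apply]

theorem single_nonneg {n : ℕ} (j l : Fin n ⊕ Fin n) :
    0 ≤ (EuclideanSpace.single j (1 : ℝ) : EE n) l := by
  simp only [PiLp.single_apply]
  split_ifs <;> norm_num

theorem reach_p {n : ℕ} {κ : Type*} [Fintype κ] (c c' : κ → EE n) (t : Fin n → κ → ℝ)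
    (h : ∀ i k l, t i k = t i l ∨ 1 ≤ |c k (Sum.inl i) - c l (Sum.inl i)|)
    (h1 : ∀ k i, c' k (Sum.inl i) = c k (Sum.inl i))
    (h2 : ∀ k i, c' k (Sum.inr i) = c k (Sum.inr i) + t i k) : Reach c c' := by
  classical
  have key : ∀ s : Finset (Fin n), Reach c (fun k => (WithLp.toLp 2 (Sum.elim
      (fun i => c k (Sum.inl i)) (fun i => c k (Sum.inr i) + if i ∈ s then t i k else 0)) : EE n)) := by
    intro s
    induction s using Finset.induction_on with
    | empty =>
      convert Reach.refl c using 1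
      funext k
      apply EE_ext <;> simp
    | insert i s hi ih =>
      refine ih.trans ?_
      convert reach_move _ (EuclideanSpace.single (Sum.inl i) 1) (t i) (single_nonneg _)
        (by rw [sum_single_one]; norm_num) ?_ using 1
      · funext k
        apply EE_ext
        · intro j
          simp [Jv_inl]
        · intro j
          simp only [PiLp.add_apply, PiLp.smul_apply, Jv_inr, PiLp.single_apply, Sum.elim_inr,
            Finset.mem_insert, Sum.inl.injEq]
          by_cases hj : j = i
          · subst hj; simp [hi]
          · simp [hj]
      · intro k l
        rw [sum_single_one, dotw_single, dotw_single]
        exact h i k l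
  convert key Finset.univ using 1
  funext k
  apply EE_ext
  · intro i; simp [h1]
  · intro i; simp [h2]

theorem reach_q {n : ℕ} {κ : Type*} [Fintype κ] (c c' : κ → EE n) (t : Fin n → κ → ℝ)
    (h : ∀ i k l, t i k = t i l ∨ 1 ≤ |c k (Sum.inr i) - c l (Sum.inr i)|)
    (h1 : ∀ k i, c' k (Sum.inr i) = c k (Sum.inr i))
    (h2 : ∀ k i, c' k (Sum.inl i) = c k (Sum.inl i) + t i k) : Reach c c' := by
  classical
  have key : ∀ s : Finset (Fin n), Reach c (fun k => (WithLp.toLp 2 (Sum.elim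
      (fun i => c k (Sum.inl i) + if i ∈ s then t i k else 0) (fun i => c k (Sum.inr i))) : EE n)) := by
    intro s
    induction s using Finset.induction_on with
    | empty =>
      convert Reach.refl c using 1
      funext k
      apply EE_ext <;> simp
    | insert i s hi ih =>
      refine ih.trans ?_
      convert reach_move _ (EuclideanSpace.single (Sum.inr i) 1) (fun k => - t i k)
        (single_nonneg _) (by rw [sum_single_one]; norm_num) ?_ using 1
      · funext k
        apply EE_ext
        · intro j
          simp only [PiLp.add_apply, PiLp.smul_apply, Jv_inl, PiLp.single_apply, Sum.elim_inl,
            Finset.mem_insert, Sum.inr.injEq]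
          by_cases hj : j = i
          · subst hj; simp [hi]
          · simp [hj]
        · intro j
          simp [Jv_inr]
      · intro k l
        rw [sum_single_one, dotw_single, dotw_single]
        simpa using h i k l
  convert key Finset.univ using 1
  funext k
  apply EE_ext
  · intro i; simp [h2]
  · intro i; simp [h1]

/-- Simultaneous translation of all momenta. -/
theorem reach_diag {n : ℕ} (hn : 1 ≤ n) {κ : Type*} [Fintype κ] (c c' : κ → EE n) (t : κ → ℝ)
    (h : ∀ k l, t k = t l ∨ (n : ℝ) ≤ |∑ i, c k (Sum.inl i) - ∑ i, c l (Sum.inl i)|)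
    (h1 : ∀ k i, c' k (Sum.inl i) = c k (Sum.inl i))
    (h2 : ∀ k i, c' k (Sum.inr i) = c k (Sum.inr i) + t k) : Reach c c' := by
  convert reach_move c (WithLp.toLp 2 (Sum.elim (fun _ => 1) (fun _ => 0)) : EE n) t ?_ ?_ ?_ using 1
  · funext k
    apply EE_ext
    · intro j; simp [Jv_inl, h1]
    · intro j; simp [Jv_inr, h2]
  · rintro (j | j) <;> simp
  · simp; omega
  · intro k l
    simpa [dotw_apply] using h k l

/-- finite sets of real numbers are bounded -/
theorem exists_bound {β : Type*} [Finite β] (f : β → ℝ) : ∃ B : ℕ, ∀ b, |f b| ≤ B := by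
  obtain ⟨M, hM⟩ := (Set.finite_range (fun b => |f b|)).bddAbove
  obtain ⟨B, hB⟩ := exists_nat_ge M
  exact ⟨B, fun b => (hM ⟨b, rfl⟩).trans hB⟩

theorem int_sep {a b : ℤ} (h : a ≠ b) : (1 : ℝ) ≤ |(a : ℝ) - b| := by
  have : (1 : ℤ) ≤ |a - b| := Int.one_le_abs (sub_ne_zero.2 h)
  exact_mod_cast this

/-- a real vector not orthogonal to finitely many nonzero vectors -/
theorem exists_generic {n : ℕ} {β : Type*} [Finite β] (v : β → Fin n → ℝ) :
    ∃ D : Fin n → ℝ, ∀ b, v b ≠ 0 → ∑ i, D i * v b i ≠ 0 := by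
  obtain ⟨f, hf⟩ := Module.exists_dual_forall_apply_ne_zero (K := ℝ)
    (fun b : {b // v b ≠ 0} => v b.1) (fun b => b.2)
  refine ⟨fun i => f (Pi.single i 1), fun b hb => ?_⟩
  have h1 := hf ⟨b, hb⟩
  have h2 : f (v b) = ∑ i, f (Pi.single i 1) * v b i := by
    conv_lhs => rw [pi_eq_sum_univ' (v b)]
    simp only [map_sum, map_smul, smul_eq_mul]
    refine Finset.sum_congr rfl fun i _ => ?_
    rw [mul_comm]
  rwa [h2] at h1

theorem reach_canonical {n : ℕ} (hn : 1 ≤ n) {κ : Type*} [Fintype κ] (e : κ → ℕ)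
    (he : Function.Injective e)
    (z : κ → Fin n ⊕ Fin n → ℤ) (hz : Function.Injective z) :
    Reach (fun k => (WithLp.toLp 2 (fun j => (z k j : ℝ)) : EE n))
      (fun k => (WithLp.toLp 2 (Sum.elim (fun _ => (e k : ℝ)) (fun _ => 0)) : EE n)) := by
  classical
  -- step 1
  obtain ⟨B0, hB0⟩ := exists_bound (fun b : κ × Fin n => (z b.1 (Sum.inr b.2) : ℝ))
  set B : ℤ := 2 * B0 + 1 with hB
  set P : κ → Fin n → ℤ := fun k i => z k (Sum.inr i) + B * z k (Sum.inl i) with hP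
  have hPinj : ∀ k l, k ≠ l → ∃ i, P k i ≠ P l i := by
    intro k l hkl
    by_contra hcon
    push Not at hcon
    apply hkl
    apply hz
    have hboth : ∀ i, z k (Sum.inl i) = z l (Sum.inl i) ∧ z k (Sum.inr i) = z l (Sum.inr i) := by
      intro i
      have h1 := hcon i
      have hk : |z k (Sum.inr i)| ≤ (B0 : ℤ) := by exact_mod_cast hB0 (k, i)
      have hl : |z l (Sum.inr i)| ≤ (B0 : ℤ) := by exact_mod_cast hB0 (l, i)
      rw [abs_le] at hk hl
      have h2 : z k (Sum.inl i) = z l (Sum.inl i) := by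
        by_contra hne
        simp only [hP] at h1
        rcases lt_or_gt_of_ne hne with h3 | h3 <;> nlinarith
      refine ⟨h2, ?_⟩
      simp only [hP, h2] at h1
      linarith
    funext j
    rcases j with i | i
    · exact (hboth i).1
    · exact (hboth i).2
  have r1 : Reach (fun k => (WithLp.toLp 2 (fun j => (z k j : ℝ)) : EE n))
      (fun k => (WithLp.toLp 2 (Sum.elim (fun i => (z k (Sum.inl i) : ℝ))
        (fun i => (P k i : ℝ))) : EE n)) := by
    refine reach_p _ _ (fun i k => B * z k (Sum.inl i)) ?_ ?_ ?_
    · intro i k l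
      by_cases h : z k (Sum.inl i) = z l (Sum.inl i)
      · left; simp [h]
      · right; simpa using int_sep h
    · intro k i; simp
    · intro k i; simp [hP]
  -- step 2
  obtain ⟨D0, hD0⟩ := exists_generic (fun b : κ × κ => fun i => (P b.1 i : ℝ) - P b.2 i)
  obtain ⟨A, hA⟩ := exists_bound (fun b : κ × κ => (∑ i, (z b.1 (Sum.inl i) : ℝ)) -
    ∑ i, (z b.2 (Sum.inl i) : ℝ))
  obtain ⟨G, hG⟩ := exists_bound
    (fun b : κ × κ => (∑ i, D0 i * ((P b.1 i : ℝ) - P b.2 i))⁻¹)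
  set Q : κ → Fin n → ℝ := fun k i => z k (Sum.inl i) + ((n + A) * G) * D0 i * P k i with hQ
  have hQsep : ∀ k l, k ≠ l → (n : ℝ) ≤ |∑ i, Q k i - ∑ i, Q l i| := by
    intro k l hkl
    obtain ⟨i, hi⟩ := hPinj k l hkl
    have h1 := hD0 (k, l) (by
      intro h
      have := congrFun h i
      simp only [Pi.zero_apply] at this
      exact hi (by exact_mod_cast sub_eq_zero.1 this))
    have h2 := hG (k, l)
    have h3 := hA (k, l)
    simp only at h1 h2 h3
    set X := ∑ i, D0 i * ((P k i : ℝ) - P l i) with hX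
    have h4 : 1 ≤ G * |X| := by
      rw [abs_inv] at h2
      have := mul_le_mul_of_nonneg_right h2 (abs_nonneg X)
      rwa [inv_mul_cancel₀ (abs_ne_zero.2 h1)] at this
    have h5 : ∑ i, Q k i - ∑ i, Q l i = ((∑ i, (z k (Sum.inl i) : ℝ)) -
        ∑ i, (z l (Sum.inl i) : ℝ)) + ((n + A) * G) * X := by
      simp only [hQ, hX, Finset.sum_add_distrib, Finset.mul_sum, mul_sub, Finset.sum_sub_distrib,
        mul_assoc]
      ring
    rw [h5]
    have h6 : |(((n : ℝ) + A) * G) * X| ≥ n + A := by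
      rw [abs_mul, abs_of_nonneg (by positivity), mul_assoc]
      exact le_mul_of_one_le_right (by positivity) h4
    set Y := ((∑ i, (z k (Sum.inl i) : ℝ)) - ∑ i, (z l (Sum.inl i) : ℝ))
    have h7 := abs_sub_abs_le_abs_sub (((n : ℝ) + A) * G * X) (-Y)
    rw [abs_neg] at h7
    calc (n : ℝ) ≤ |((n : ℝ) + A) * G * X| - |Y| := by linarith
      _ ≤ _ := h7
      _ = _ := by congr 1; ring
  have r2 : Reach (fun k => (WithLp.toLp 2 (Sum.elim (fun i => (z k (Sum.inl i) : ℝ))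
        (fun i => (P k i : ℝ))) : EE n))
      (fun k => (WithLp.toLp 2 (Sum.elim (fun i => Q k i) (fun i => (P k i : ℝ))) : EE n)) := by
    refine reach_q _ _ (fun i k => ((n + A) * G) * D0 i * P k i) ?_ ?_ ?_
    · intro i k l
      by_cases h : P k i = P l i
      · left; simp [h]
      · right; simpa using int_sep h
    · intro k i; simp
    · intro k i; simp [hQ]
  -- step 3
  obtain ⟨H, hH⟩ := exists_bound (fun b : κ × κ × Fin n => (P b.1 b.2.2 : ℝ) - P b.2.1 b.2.2)
  set t : κ → ℝ := fun k => (H + 1) * e k with ht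
  have r3 : Reach (fun k => (WithLp.toLp 2 (Sum.elim (fun i => Q k i) (fun i => (P k i : ℝ))) : EE n))
      (fun k => (WithLp.toLp 2 (Sum.elim (fun i => Q k i) (fun i => P k i + t k)) : EE n)) := by
    refine reach_diag hn _ _ t ?_ ?_ ?_
    · intro k l
      by_cases h : k = l
      · left; simp [h]
      · right; simpa using hQsep k l h
    · intro k i; simp
    · intro k i; simp
  have hsep : ∀ k l i, k ≠ l → 1 ≤ |((P k i : ℝ) + t k) - (P l i + t l)| := by
    intro k l i hkl
    have h1 := hH (k, l, i)
    simp only at h1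
    have h2 : (1 : ℝ) ≤ |(e k : ℝ) - e l| := by
      have := int_sep (a := e k) (b := e l) (by exact_mod_cast fun h => hkl (he h))
      simpa using this
    have h3 : |((H : ℝ) + 1) * (e k - e l)| ≥ H + 1 := by
      rw [abs_mul, abs_of_nonneg (by positivity)]
      exact le_mul_of_one_le_right (by positivity) h2
    have h7 := abs_sub_abs_le_abs_sub (((H : ℝ) + 1) * (e k - e l)) (-((P k i : ℝ) - P l i))
    rw [abs_neg] at h7
    calc (1 : ℝ) ≤ _ := by linarith
      _ ≤ _ := h7
      _ = _ := by congr 1; simp only [ht]; ring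
  -- step 4
  have r4 : Reach (fun k => (WithLp.toLp 2 (Sum.elim (fun i => Q k i) (fun i => P k i + t k)) : EE n))
      (fun k => (WithLp.toLp 2 (Sum.elim (fun _ => (e k : ℝ)) (fun i => P k i + t k)) : EE n)) := by
    refine reach_q _ _ (fun i k => e k - Q k i) ?_ ?_ ?_
    · intro i k l
      by_cases h : k = l
      · left; simp [h]
      · right; simpa using hsep k l i h
    · intro k i; simp
    · intro k i; simp
  have r5 : Reach (fun k => (WithLp.toLp 2 (Sum.elim (fun _ => (e k : ℝ)) (fun i => P k i + t k)) : EE n))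
      (fun k => (WithLp.toLp 2 (Sum.elim (fun _ => (e k : ℝ)) (fun _ => 0)) : EE n)) := by
    refine reach_p _ _ (fun i k => - (P k i + t k)) ?_ ?_ ?_
    · intro i k l
      by_cases h : k = l
      · left; simp [h]
      · right
        have := int_sep (a := e k) (b := e l) (by exact_mod_cast fun h' => h (he h'))
        simpa using this
    · intro k i; simp
    · intro k i; simp
  exact r1.trans (r2.trans (r3.trans (r4.trans r5)))

theorem reach_perm {n : ℕ} (hn : 1 ≤ n) {κ : Type*} [Fintype κ]
    (z z' : κ → Fin n ⊕ Fin n → ℤ) (hz : Function.Injective z) (hz' : Function.Injective z') :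
    Reach (fun k => (WithLp.toLp 2 (fun j => (z k j : ℝ)) : EE n))
      (fun k => (WithLp.toLp 2 (fun j => (z' k j : ℝ)) : EE n)) := by
  have e : κ → ℕ := fun k => (Fintype.equivFin κ k : ℕ)
  have h1 := reach_canonical hn (fun k => (Fintype.equivFin κ k : ℕ))
    (fun a b h => (Fintype.equivFin κ).injective (Fin.ext h)) z hz
  have h2 := reach_canonical hn (fun k => (Fintype.equivFin κ k : ℕ))
    (fun a b h => (Fintype.equivFin κ).injective (Fin.ext h)) z' hz'
  exact h1.trans h2.symm

/-- Rescaled version: cubes of side `h`. -/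
theorem perm_scaled {n : ℕ} (hn : 1 ≤ n) {κ : Type*} [Fintype κ] {h : ℝ} (hh : 0 < h)
    (z z' : κ → Fin n ⊕ Fin n → ℤ) (hz : Function.Injective z) (hz' : Function.Injective z') :
    ∃ M : ℝ, ∀ δ : ℝ, 0 < δ → ∃ S S' : EE n → EE n, NicePair M S S' ∧
      ∀ k, ∀ x : EE n, (∀ j, h * (z k j + δ) ≤ x j ∧ x j ≤ h * (z k j + 1 - δ)) →
        ∀ j, S x j = x j + h * (z' k j - z k j) := by
  obtain ⟨M, hM⟩ := reach_perm hn z z' hz hz'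
  refine ⟨h * M, fun δ hδ => ?_⟩
  obtain ⟨S, S', hS, hS2⟩ := hM δ hδ
  have hne : h ≠ 0 := hh.ne'
  have nice : ∀ T : EE n → EE n, Nice T → Nice (fun x => h • T (h⁻¹ • x)) := by
    intro T hT
    refine ⟨(hT.1.comp (contDiff_id.const_smul h⁻¹)).const_smul h, fun x => ?_⟩
    have hd : HasFDerivAt (fun x => h • T (h⁻¹ • x)) (fderiv ℝ T (h⁻¹ • x)) x := by
      have h1 : HasFDerivAt T (fderiv ℝ T (h⁻¹ • x)) (h⁻¹ • x) :=
        ((hT.1.differentiable (by norm_num)) _).hasFDerivAt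
      have h2 : HasFDerivAt (fun x : EE n => h⁻¹ • x) (h⁻¹ • ContinuousLinearMap.id ℝ (EE n)) x :=
        (hasFDerivAt_id x).const_smul h⁻¹
      have h3 := (HasFDerivAt.comp (f := fun x : EE n => h⁻¹ • x) x h1 h2).const_smul h
      have h4 : h • (fderiv ℝ T (h⁻¹ • x)).comp (h⁻¹ • ContinuousLinearMap.id ℝ (EE n)) =
          fderiv ℝ T (h⁻¹ • x) := by
        ext v
        simp [hne]
      rw [h4] at h3
      exact h3
    have : matD (fun x => h • T (h⁻¹ • x)) x = matD T (h⁻¹ • x) := by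
      unfold matD
      rw [hd.fderiv]
    rw [this]
    exact hT.2 _
  refine ⟨fun x => h • S (h⁻¹ • x), fun x => h • S' (h⁻¹ • x), ⟨nice S hS.1, nice S' hS.2.1,
    fun x => ?_, fun x => ?_, fun x => ?_⟩, fun k x hx j => ?_⟩
  · simp [hne, smul_smul, hS.2.2.1]
  · simp [hne, smul_smul, hS.2.2.2.1]
  · have h1 := hS.2.2.2.2 (h⁻¹ • x)
    have : h • S (h⁻¹ • x) - x = h • (S (h⁻¹ • x) - h⁻¹ • x) := by
      rw [smul_sub, smul_smul, mul_inv_cancel₀ hne, one_smul]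
    rw [this, norm_smul, Real.norm_eq_abs, abs_of_pos hh]
    gcongr
  · have h1 := hS2 k (h⁻¹ • x) (by
      intro j
      have := hx j
      simp only [PiLp.smul_apply, smul_eq_mul]
      constructor
      · rw [← mul_le_mul_iff_of_pos_left hh, mul_inv_cancel_left₀ hne]; exact this.1
      · rw [← mul_le_mul_iff_of_pos_left hh, mul_inv_cancel_left₀ hne]; exact this.2)
    simp only [h1, PiLp.smul_apply, PiLp.add_apply, PiLp.sub_apply, smul_eq_mul]
    field_simp


def cell {n : ℕ} (h : ℝ) (z : Fin n ⊕ Fin n → ℤ) : Set (EE n) :=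
  {x | ∀ j, h * z j ≤ x j ∧ x j < h * (z j + 1)}

def stile {n : ℕ} (h δ : ℝ) (z : Fin n ⊕ Fin n → ℤ) : Set (EE n) :=
  {x | ∀ j, h * (z j + δ) ≤ x j ∧ x j ≤ h * (z j + 1 - δ)}

theorem norm_le_of_coord {n : ℕ} {x : EE n} {a : ℝ} (h : ∀ j, |x j| ≤ a) : ‖x‖ ≤ (2 * n) * a := by
  have hx : x = ∑ j, x j • EuclideanSpace.single j (1 : ℝ) := by
    ext i
    rcases i with i | i <;> simp [Finset.sum_apply, Pi.single_apply]
  calc ‖x‖ = ‖∑ j, x j • (EuclideanSpace.single j (1 : ℝ) : EE n)‖ := by rw [← hx]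
    _ ≤ ∑ j, ‖x j • (EuclideanSpace.single j (1 : ℝ) : EE n)‖ := norm_sum_le _ _
    _ ≤ ∑ j : Fin n ⊕ Fin n, a := by
        apply Finset.sum_le_sum
        intro j _
        rw [norm_smul]
        simpa using h j
    _ = (2 * n) * a := by
        rw [Finset.sum_const, nsmul_eq_mul]
        simp only [Finset.card_univ, Fintype.card_sum, Fintype.card_fin]
        push_cast; ring

theorem coord_le_norm {n : ℕ} (x : EE n) (j : Fin n ⊕ Fin n) : |x j| ≤ ‖x‖ :=
  PiLp.norm_apply_le x j

theorem cell_dist {n : ℕ} {h : ℝ} {z : Fin n ⊕ Fin n → ℤ} {x y : EE n}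
    (hx : x ∈ cell h z) (hy : y ∈ cell h z) : ‖x - y‖ ≤ (2 * n) * h := by
  apply norm_le_of_coord
  intro j
  have h1 := hx j
  have h2 := hy j
  have : (x - y) j = x j - y j := rfl
  rw [this, abs_le]
  constructor <;> linarith [h1.1, h1.2, h2.1, h2.2]

theorem mem_cell_floor {n : ℕ} {h : ℝ} (hh : 0 < h) (x : EE n) :
    x ∈ cell h (fun j => ⌊x j / h⌋) := by
  intro j
  have h1 := Int.floor_le (x j / h)
  have h2 := Int.lt_floor_add_one (x j / h)
  rw [le_div_iff₀ hh] at h1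
  rw [div_lt_iff₀ hh] at h2
  constructor <;> linarith

theorem cell_unique {n : ℕ} {h : ℝ} (hh : 0 < h) {z z' : Fin n ⊕ Fin n → ℤ} {x : EE n}
    (hx : x ∈ cell h z) (hx' : x ∈ cell h z') : z = z' := by
  funext j
  have h1 := hx j
  have h2 := hx' j
  have h3 : (z j : ℝ) < z' j + 1 := by
    by_contra hc
    push Not at hc
    nlinarith [mul_le_mul_of_nonneg_left hc hh.le]
  have h4 : (z' j : ℝ) < z j + 1 := by
    by_contra hc
    push Not at hc
    nlinarith [mul_le_mul_of_nonneg_left hc hh.le]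
  have h5 : z j < z' j + 1 := by exact_mod_cast h3
  have h6 : z' j < z j + 1 := by exact_mod_cast h4
  omega

theorem measurableSet_cell {n : ℕ} (h : ℝ) (z : Fin n ⊕ Fin n → ℤ) :
    MeasurableSet (cell h z) := by
  have : cell h z = ⋂ j, ({x : EE n | h * z j ≤ x j} ∩ {x : EE n | x j < h * (z j + 1)}) := by
    ext x; simp [cell]
  rw [this]
  refine MeasurableSet.iInter fun j => ?_
  have hm : Measurable fun x : EE n => x j := by
    have : Continuous fun x : EE n => x j := by fun_prop
    exact this.measurable
  exact (measurableSet_le measurable_const hm).inter (measurableSet_lt hm measurable_const)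

theorem measurableSet_stile {n : ℕ} (h δ : ℝ) (z : Fin n ⊕ Fin n → ℤ) :
    MeasurableSet (stile h δ z) := by
  have : stile h δ z = ⋂ j, ({x : EE n | h * (z j + δ) ≤ x j} ∩ {x : EE n | x j ≤ h * (z j + 1 - δ)}) := by
    ext x; simp [stile]
  rw [this]
  refine MeasurableSet.iInter fun j => ?_
  have hm : Measurable fun x : EE n => x j := by
    have : Continuous fun x : EE n => x j := by fun_prop
    exact this.measurable
  exact (measurableSet_le measurable_const hm).inter (measurableSet_le hm measurable_const)

theorem volume_cell {n : ℕ} {h : ℝ} (hh : 0 < h) (z : Fin n ⊕ Fin n → ℤ) :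
    volume (cell h z) = ENNReal.ofReal (h ^ (2 * n)) := by
  have h1 : cell h z = (WithLp.ofLp : EE n → _) ⁻¹'
      (Set.pi Set.univ fun j => Set.Ico (h * z j) (h * (z j + 1))) := by
    ext x; simp [cell, Set.mem_pi]
  rw [h1, (PiLp.volume_preserving_ofLp (Fin n ⊕ Fin n)).measure_preimage
    (MeasurableSet.univ_pi fun j => measurableSet_Ico).nullMeasurableSet, Real.volume_pi_Ico]
  have : ∀ j, h * ((z j : ℝ) + 1) - h * z j = h := fun j => by ring
  simp only [this]
  rw [Finset.prod_const, ← ENNReal.ofReal_pow hh.le]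
  congr 2
  simp; ring

theorem volume_stile {n : ℕ} {h δ : ℝ} (hh : 0 < h) (hδ : δ ≤ 1/2) (z : Fin n ⊕ Fin n → ℤ) :
    volume (stile h δ z) = ENNReal.ofReal ((h * (1 - 2 * δ)) ^ (2 * n)) := by
  have h1 : stile h δ z = (WithLp.ofLp : EE n → _) ⁻¹'
      (Set.pi Set.univ fun j => Set.Icc (h * (z j + δ)) (h * (z j + 1 - δ))) := by
    ext x; simp only [stile, Set.mem_pi, Set.mem_preimage, Set.mem_univ, forall_true_left, Set.mem_Icc]; rfl
  rw [h1, (PiLp.volume_preserving_ofLp (Fin n ⊕ Fin n)).measure_preimage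
    (MeasurableSet.univ_pi fun j => measurableSet_Icc).nullMeasurableSet, Set.pi_univ_Icc, Real.volume_Icc_pi]
  have : ∀ j, h * ((z j : ℝ) + 1 - δ) - h * (z j + δ) = h * (1 - 2 * δ) := fun j => by ring
  simp only [this]
  rw [Finset.prod_const, ← ENNReal.ofReal_pow (by nlinarith)]
  congr 2
  simp; ring

theorem volumeReal_cell {n : ℕ} {h : ℝ} (hh : 0 < h) (z : Fin n ⊕ Fin n → ℤ) :
    volume.real (cell h z) = h ^ (2 * n) := by
  rw [Measure.real, volume_cell hh, ENNReal.toReal_ofReal (by positivity)]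

theorem stile_subset_cell {n : ℕ} {h δ : ℝ} (hh : 0 < h) (hδ : 0 < δ) (z : Fin n ⊕ Fin n → ℤ) :
    stile h δ z ⊆ cell h z := by
  intro x hx j
  have := hx j
  constructor <;> nlinarith

theorem volumeReal_cell_diff {n : ℕ} {h δ : ℝ} (hh : 0 < h) (hδ : 0 < δ) (hδ' : δ ≤ 1/2)
    (z : Fin n ⊕ Fin n → ℤ) :
    volume.real (cell h z \ stile h δ z) = h ^ (2 * n) - (h * (1 - 2 * δ)) ^ (2 * n) := by
  have hc : volume (cell h z) ≠ ⊤ := by rw [volume_cell hh]; exact ENNReal.ofReal_ne_top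
  have h0 : 0 ≤ h * (1 - 2 * δ) := by nlinarith
  rw [measureReal_sdiff (stile_subset_cell hh hδ z) (measurableSet_stile h δ z) hc, volumeReal_cell hh,
    Measure.real, volume_stile hh hδ', ENNReal.toReal_ofReal (by positivity)]

theorem cell_shift {n : ℕ} {h δ : ℝ} (hh : 0 < h) (hδ : 0 < δ) {z z' : Fin n ⊕ Fin n → ℤ} {x y : EE n}
    (hx : x ∈ stile h δ z) (hy : ∀ j, y j = x j + h * (z' j - z j)) : y ∈ cell h z' := by
  intro j
  have := stile_subset_cell hh hδ z hx j
  rw [hy j]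
  constructor <;> nlinarith [this.1, this.2]


def Good {n : ℕ} (h θ : ℝ) (V : Set (EE n)) (z : Fin n ⊕ Fin n → ℤ) : Prop :=
  (1 - θ) * h ^ (2 * n) ≤ volume.real (V ∩ cell h z)

theorem cell_ne_top {n : ℕ} {h : ℝ} (hh : 0 < h) (z : Fin n ⊕ Fin n → ℤ) :
    volume (cell h z) ≠ ⊤ := by rw [volume_cell hh]; exact ENNReal.ofReal_ne_top

theorem cells_disjoint {n : ℕ} {h : ℝ} (hh : 0 < h) {z z' : Fin n ⊕ Fin n → ℤ} (hz : z ≠ z') :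
    Disjoint (cell h z) (cell h z') := by
  rw [Set.disjoint_left]
  intro x h1 h2
  exact hz (cell_unique hh h1 h2)

theorem matching {n : ℕ} {V : Set (EE n)} (hV : MeasurableSet V) (hVfin : volume V ≠ ⊤)
    {F : EE n → EE n} {h θ : ℝ} (hh : 0 < h) (hθ : θ < 1)
    (Z : Finset (Fin n ⊕ Fin n → ℤ)) (hFZ : ∀ x ∈ V, ∃ l ∈ Z, F x ∈ cell h l)
    (hpush : ∀ B, MeasurableSet B → volume B ≠ ⊤ →
      volume.real (V ∩ F ⁻¹' B) ≤ (1 - θ) * volume.real B) :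
    ∃ τ : {z // Good h θ V z} → (Fin n ⊕ Fin n → ℤ), Function.Injective τ ∧
      ∀ z, τ z ∈ Z ∧ ∃ x ∈ V ∩ cell h z.1, F x ∈ cell h (τ z) := by
  classical
  have key := (Finset.all_card_le_biUnion_card_iff_exists_injective
    (fun z : {z // Good h θ V z} => Z.filter (fun l => ∃ x ∈ V ∩ cell h z.1, F x ∈ cell h l))).1 ?_
  · obtain ⟨τ, h1, h2⟩ := key
    exact ⟨τ, h1, fun z => by simpa using h2 z⟩
  intro A
  set B := A.biUnion (fun z : {z // Good h θ V z} =>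
    Z.filter (fun l => ∃ x ∈ V ∩ cell h z.1, F x ∈ cell h l)) with hB
  have hcell : ∀ z ∈ A, (1 - θ) * h ^ (2 * n) ≤ volume.real (V ∩ cell h z.1) := fun z _ => z.2
  have h1 : (A.card : ℝ) * ((1 - θ) * h ^ (2 * n)) ≤ ∑ z ∈ A, volume.real (V ∩ cell h z.1) := by
    rw [← nsmul_eq_mul, ← Finset.sum_const]
    exact Finset.sum_le_sum hcell
  have h2 : ∑ z ∈ A, volume.real (V ∩ cell h z.1) = volume.real (⋃ z ∈ A, V ∩ cell h z.1) := by
    rw [measureReal_biUnion_finset (h := fun z _ =>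
      ne_top_of_le_ne_top hVfin (measure_mono Set.inter_subset_left))]
    · intro z _ z' _ hzz
      have : z.1 ≠ z'.1 := fun hc => hzz (Subtype.ext hc)
      exact (cells_disjoint hh this).mono Set.inter_subset_right Set.inter_subset_right
    · intro z _
      exact hV.inter (measurableSet_cell h z.1)
  have hBm : MeasurableSet (⋃ l ∈ B, cell h l) :=
    Finset.measurableSet_biUnion _ fun l _ => measurableSet_cell h l
  have hBv : volume.real (⋃ l ∈ B, cell h l) = B.card * h ^ (2 * n) := by
    rw [measureReal_biUnion_finset (h := fun z _ => cell_ne_top hh z)]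
    · simp [volumeReal_cell hh]
    · intro z _ z' _ hzz
      exact cells_disjoint hh hzz
    · intro z _
      exact measurableSet_cell h z
  have hBf : volume (⋃ l ∈ B, cell h l) ≠ ⊤ :=
    (measure_biUnion_lt_top B.finite_toSet fun l _ => (cell_ne_top hh l).lt_top).ne
  have h3 : volume.real (⋃ z ∈ A, V ∩ cell h z.1) ≤ volume.real (V ∩ F ⁻¹' (⋃ l ∈ B, cell h l)) := by
    apply measureReal_mono
    · intro x hx
      simp only [Set.mem_iUnion] at hx
      obtain ⟨z, hzA, hx⟩ := hx
      obtain ⟨l, hl, hFl⟩ := hFZ x hx.1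
      refine ⟨hx.1, ?_⟩
      simp only [Set.mem_preimage, Set.mem_iUnion]
      refine ⟨l, ?_, hFl⟩
      rw [hB, Finset.mem_biUnion]
      exact ⟨z, hzA, Finset.mem_filter.2 ⟨hl, x, hx, hFl⟩⟩
    · exact ne_top_of_le_ne_top hVfin (measure_mono Set.inter_subset_left)
  have h4 := hpush _ hBm hBf
  rw [hBv] at h4
  have h5 : (A.card : ℝ) * ((1 - θ) * h ^ (2 * n)) ≤ B.card * ((1 - θ) * h ^ (2 * n)) := by
    calc _ ≤ _ := h1
      _ = _ := h2
      _ ≤ _ := h3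
      _ ≤ _ := h4
      _ = _ := by ring
  have h6 : 0 < (1 - θ) * h ^ (2 * n) := mul_pos (by linarith) (by positivity)
  exact_mod_cast le_of_mul_le_mul_right h5 h6

theorem bad_measure {n : ℕ} {U V K : Set (EE n)} (hUf : volume U ≠ ⊤)
    (hV : MeasurableSet V) {h θ : ℝ} (hh : 0 < h) (hθ : 0 < θ)
    (Z : Finset (Fin n ⊕ Fin n → ℤ)) (hK : ∀ z, (cell h z ∩ K).Nonempty → cell h z ⊆ U) :
    volume.real (⋃ z ∈ (Z : Set (Fin n ⊕ Fin n → ℤ)) ∩ {z | ¬ Good h θ V z}, U ∩ cell h z)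
      ≤ volume.real (U \ K) + θ⁻¹ * volume.real (U \ V) := by
  classical
  set A := Z.filter (fun z => ¬ Good h θ V z ∧ (cell h z ∩ K).Nonempty) with hA
  have hsub : (⋃ z ∈ (Z : Set (Fin n ⊕ Fin n → ℤ)) ∩ {z | ¬ Good h θ V z}, U ∩ cell h z) ⊆
      (U \ K) ∪ ⋃ z ∈ A, cell h z := by
    intro x hx
    simp only [Set.mem_iUnion] at hx
    obtain ⟨z, hz, hxU, hxz⟩ := hx
    by_cases hxK : x ∈ K
    · right
      simp only [Set.mem_iUnion]
      exact ⟨z, by rw [hA, Finset.mem_filter]; exact ⟨hz.1, hz.2, x, hxz, hxK⟩, hxz⟩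
    · left; exact ⟨hxU, hxK⟩
  have hAU : ∀ z ∈ A, cell h z ⊆ U := fun z hz => hK z (Finset.mem_filter.1 hz).2.2
  have hAf : volume (⋃ z ∈ A, cell h z) ≠ ⊤ :=
    (measure_biUnion_lt_top A.finite_toSet fun l _ => (cell_ne_top hh l).lt_top).ne
  have h0 : volume (U \ K) ≠ ⊤ := ne_top_of_le_ne_top hUf (measure_mono Set.sdiff_subset)
  have h1 : ∀ z ∈ A, volume.real (cell h z) ≤ θ⁻¹ * volume.real (cell h z \ V) := by
    intro z hz
    have hb : ¬ Good h θ V z := (Finset.mem_filter.1 hz).2.1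
    unfold Good at hb
    push Not at hb
    have h2 := measureReal_inter_add_sdiff (μ := volume) (s := cell h z) hV (cell_ne_top hh z)
    rw [Set.inter_comm, volumeReal_cell hh] at h2
    rw [volumeReal_cell hh, le_inv_mul_iff₀ hθ]
    linarith
  have h2 : ∑ z ∈ A, volume.real (cell h z \ V) ≤ volume.real (U \ V) := by
    rw [← measureReal_biUnion_finset (h := fun z _ =>
      ne_top_of_le_ne_top (cell_ne_top hh z) (measure_mono Set.sdiff_subset))]
    · apply measureReal_mono _ (ne_top_of_le_ne_top hUf (measure_mono Set.sdiff_subset))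
      intro x hx
      simp only [Set.mem_iUnion] at hx
      obtain ⟨z, hz, hx⟩ := hx
      exact ⟨hAU z hz hx.1, hx.2⟩
    · intro z _ z' _ hzz
      exact (cells_disjoint hh hzz).mono Set.sdiff_subset Set.sdiff_subset
    · intro z _
      exact (measurableSet_cell h z).diff hV
  calc _ ≤ volume.real ((U \ K) ∪ ⋃ z ∈ A, cell h z) :=
        measureReal_mono hsub (measure_union_ne_top h0 hAf)
    _ ≤ volume.real (U \ K) + volume.real (⋃ z ∈ A, cell h z) := measureReal_union_le _ _
    _ ≤ volume.real (U \ K) + ∑ z ∈ A, volume.real (cell h z) := by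
        gcongr; exact measureReal_biUnion_finset_le _ _
    _ ≤ volume.real (U \ K) + ∑ z ∈ A, θ⁻¹ * volume.real (cell h z \ V) := by
        gcongr with z hz; exact h1 z hz
    _ ≤ _ := by
        rw [← Finset.mul_sum]
        gcongr

def grid {n : ℕ} (N : ℕ) : Finset (Fin n ⊕ Fin n → ℤ) :=
  Fintype.piFinset fun _ => Finset.Icc (-(N : ℤ)) N

theorem exists_mem_grid {n : ℕ} {h R : ℝ} (hh : 0 < h) {N : ℕ} (hN : R / h + 1 ≤ N) {x : EE n}
    (hx : ‖x‖ ≤ R) : ∃ z ∈ grid N, x ∈ cell h z := by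
  refine ⟨_, ?_, mem_cell_floor hh x⟩
  rw [grid, Fintype.mem_piFinset]
  intro j
  have h1 := (coord_le_norm x j).trans hx
  rw [abs_le] at h1
  have h2 : x j / h ≤ R / h := by gcongr; exact h1.2
  have h3 : -(R / h) ≤ x j / h := by rw [← neg_div]; gcongr; exact h1.1
  rw [Finset.mem_Icc]
  constructor
  · apply Int.le_floor.2
    push_cast
    linarith
  · have := Int.floor_le (x j / h)
    have h4 : (⌊x j / h⌋ : ℝ) ≤ (N : ℤ) := by push_cast; linarith
    exact_mod_cast h4


set_option maxHeartbeats 1000000 in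
theorem approx_cells {n : ℕ} (hn : 1 ≤ n) {U V : Set (EE n)} (hUf : volume U ≠ ⊤)
    (hV : MeasurableSet V) (hVU : V ⊆ U) {F : EE n → EE n} {R : ℝ} (hR : 1 ≤ R)
    (hUR : ∀ x ∈ U, ‖x‖ ≤ R) (hFR : ∀ x ∈ U, ‖F x‖ ≤ R) {θ : ℝ} (hθ1 : θ < 1)
    (hpush : ∀ B, MeasurableSet B → volume B ≠ ⊤ →
      volume.real (V ∩ F ⁻¹' B) ≤ (1 - θ) * volume.real B)
    {h s : ℝ} (hh : 0 < h) (hh1 : h ≤ 1) (hs : (2 * n) * h ≤ s / 2)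
    (hunif : ∀ x ∈ U, ∀ y ∈ U, ‖x - y‖ ≤ (2 * n) * h → ‖F x - F y‖ ≤ s / 2) :
    ∃ N : ℕ, R / h + 1 ≤ N ∧ ∃ M : ℝ, ∀ δ : ℝ, 0 < δ → ∃ S S' : EE n → EE n, NicePair M S S' ∧
      ∀ z ∈ grid N, ∀ x ∈ U, x ∈ stile h δ z →
        (Good h θ V z → ‖F x - S x‖ ≤ s) ∧ (¬ Good h θ V z → ‖F x - S x‖ ≤ (2 + 14 * n) * R) := by
  classical
  have hVf : volume V ≠ ⊤ := ne_top_of_le_ne_top hUf (measure_mono hVU)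
  set N : ℕ := ⌈R / h⌉₊ + 1 with hNdef
  have hN1 : R / h + 1 ≤ N := by
    rw [hNdef]; push_cast; linarith [Nat.le_ceil (R / h)]
  have hRh : 0 ≤ R / h := by positivity
  have hN2 : (N : ℝ) ≤ R / h + 2 := by
    rw [hNdef]; push_cast; linarith [Nat.ceil_lt_add_one hRh]
  refine ⟨N, hN1, ?_⟩
  obtain ⟨τ, hτi, hτ⟩ := matching hV hVf hh hθ1 (grid N)
    (fun x hx => exists_mem_grid hh hN1 (hFR x (hVU hx))) hpush
  have hgrid : ∀ (z : Fin n ⊕ Fin n → ℤ), z ∈ grid N → ∀ j, -(N : ℤ) ≤ z j ∧ z j ≤ N := by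
    intro z hz j
    rw [grid, Fintype.mem_piFinset] at hz
    simpa using hz j
  let z' : {z : Fin n ⊕ Fin n → ℤ // z ∈ grid N} → Fin n ⊕ Fin n → ℤ := fun z =>
    if hg : Good h θ V z.1 then τ ⟨z.1, hg⟩ else fun j => z.1 j + (2 * N + 1)
  have hz'g : ∀ z (hg : Good h θ V z.1), z' z = τ ⟨z.1, hg⟩ := fun z hg => dif_pos hg
  have hz'b : ∀ z (hg : ¬ Good h θ V z.1), z' z = fun j => z.1 j + (2 * N + 1) := fun z hg => dif_neg hg
  let j0 : Fin n ⊕ Fin n := Sum.inl ⟨0, hn⟩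
  have hne : ∀ a b : {z : Fin n ⊕ Fin n → ℤ // z ∈ grid N}, Good h θ V a.1 → ¬ Good h θ V b.1 → z' a ≠ z' b := by
    intro a b ha hb hab
    rw [hz'g a ha, hz'b b hb] at hab
    have h1 := (hgrid _ (hτ ⟨a.1, ha⟩).1 j0).2
    have h2 := (hgrid _ b.2 j0).1
    rw [hab] at h1
    simp only at h1
    omega
  have hinj : Function.Injective z' := by
    intro a b hab
    by_cases ha : Good h θ V a.1 <;> by_cases hb : Good h θ V b.1
    · rw [hz'g a ha, hz'g b hb] at hab
      have := hτi hab
      simp only [Subtype.mk.injEq] at this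
      exact Subtype.ext this
    · exact absurd hab (hne a b ha hb)
    · exact absurd hab.symm (hne b a hb ha)
    · rw [hz'b a ha, hz'b b hb] at hab
      apply Subtype.ext
      funext j
      have := congrFun hab j
      omega
  obtain ⟨M, hM⟩ := perm_scaled hn hh (fun z : {z : Fin n ⊕ Fin n → ℤ // z ∈ grid N} => z.1) z'
    Subtype.val_injective hinj
  refine ⟨M, fun δ hδ => ?_⟩
  obtain ⟨S, S', hSS, hS⟩ := hM δ hδ
  refine ⟨S, S', hSS, fun z hz x hxU hx => ?_⟩
  have hSx := hS ⟨z, hz⟩ x hx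
  constructor
  · intro hg
    rw [hz'g ⟨z, hz⟩ hg] at hSx
    obtain ⟨y, hy, hFy⟩ := (hτ ⟨z, hg⟩).2
    have h1 := cell_shift hh hδ hx hSx
    have h2 := cell_dist hFy h1
    have h3 := hunif x hxU y (hVU hy.1) (cell_dist (stile_subset_cell hh hδ z hx) hy.2)
    calc ‖F x - S x‖ = ‖(F x - F y) + (F y - S x)‖ := by congr 1; abel
      _ ≤ ‖F x - F y‖ + ‖F y - S x‖ := norm_add_le _ _
      _ ≤ s := by linarith
  · intro hg
    rw [hz'b ⟨z, hz⟩ hg] at hSx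
    have h1 : ‖S x - x‖ ≤ (2 * n) * (7 * R) := by
      apply norm_le_of_coord
      intro j
      have : (S x - x) j = S x j - x j := rfl
      rw [this, hSx j]
      push_cast
      have e : x j + h * ((z j : ℝ) + (2 * N + 1) - z j) - x j = h * (2 * N + 1) := by ring
      rw [e, abs_of_nonneg (by positivity)]
      have : h * (R / h) = R := by field_simp
      nlinarith
    calc ‖F x - S x‖ = ‖F x - x - (S x - x)‖ := by congr 1; abel
      _ ≤ ‖F x‖ + ‖x‖ + ‖S x - x‖ := (norm_sub_le _ _).trans (by gcongr; exact norm_sub_le _ _)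
      _ ≤ R + R + (2 * n) * (7 * R) := by gcongr; exacts [hFR x hxU, hUR x hxU]
      _ = _ := by ring

theorem exists_delta (m : ℕ) {h : ℝ} {A ε : ℝ} (hε : 0 < ε) :
    ∃ δ : ℝ, 0 < δ ∧ δ ≤ 1 / 4 ∧ A * (h ^ m - (h * (1 - 2 * δ)) ^ m) ≤ ε := by
  have hc : Continuous fun δ : ℝ => A * (h ^ m - (h * (1 - 2 * δ)) ^ m) := by fun_prop
  have h0 := hc.tendsto 0
  simp only [mul_zero, sub_zero, mul_one, sub_self] at h0
  have h1 := (h0.eventually (gt_mem_nhds hε)).filter_mono (nhdsWithin_le_nhds (s := Set.Ioi 0))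
  have h2 : ∀ᶠ δ in nhdsWithin (0 : ℝ) (Set.Ioi 0), δ ∈ Set.Ioc (0 : ℝ) (1/4) :=
    Ioc_mem_nhdsGT (by norm_num)
  obtain ⟨δ, ha, hb⟩ := (h1.and h2).exists
  exact ⟨δ, hb.1, hb.2, ha.le⟩

set_option maxHeartbeats 1000000 in
theorem approx {n : ℕ} (hn : 1 ≤ n) {p : ℝ} (hp : 1 ≤ p) {U V : Set (EE n)} (hU : IsOpen U)
    (hV : MeasurableSet V) (hVU : V ⊆ U) {F : EE n → EE n} (hF : Continuous F) {R : ℝ} (hR : 1 ≤ R)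
    (hUR : ∀ x ∈ U, ‖x‖ ≤ R) (hFR : ∀ x ∈ U, ‖F x‖ ≤ R) {θ : ℝ} (hθ0 : 0 < θ) (hθ1 : θ < 1)
    (hpush : ∀ B, MeasurableSet B → volume B ≠ ⊤ →
      volume.real (V ∩ F ⁻¹' B) ≤ (1 - θ) * volume.real B)
    {η : ℝ} (hη : 0 < η) :
    ∃ (S S' : EE n → EE n) (M : ℝ), NicePair M S S' ∧
      ∫ x in U, ‖F x - S x‖ ^ p ≤ η + ((2 + 14 * n) * R) ^ p * (θ⁻¹ * volume.real (U \ V)) := by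
  classical
  have hp0 : 0 < p := by linarith
  have hUf : volume U ≠ ⊤ := by
    apply ne_top_of_le_ne_top (measure_closedBall_lt_top (μ := volume) (x := (0 : EE n)) (r := R)).ne
    apply measure_mono
    intro x hx
    simpa using hUR x hx
  set c : ℝ := (2 + 14 * n) * R with hc
  have hc0 : 0 < c := by positivity
  set vU := volume.real U with hvU
  have hvU0 : 0 ≤ vU := measureReal_nonneg
  -- scale s
  obtain ⟨s, hs0, hs⟩ : ∃ s : ℝ, 0 < s ∧ s ^ p * vU ≤ η / 3 := by
    refine ⟨(η / 3 / (vU + 1)) ^ p⁻¹, by positivity, ?_⟩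
    rw [← Real.rpow_mul (by positivity), inv_mul_cancel₀ hp0.ne', Real.rpow_one, div_mul_eq_mul_div,
      div_le_iff₀ (by positivity)]
    nlinarith
  obtain ⟨K, hKU, hKc, hK⟩ := hU.measurableSet.exists_isCompact_sdiff_lt hUf
    (ε := ENNReal.ofReal (η / 3 / c ^ p)) (by
      rw [Ne, ENNReal.ofReal_eq_zero]; push Not; positivity)
  have hKr : c ^ p * volume.real (U \ K) ≤ η / 3 := by
    have : volume.real (U \ K) ≤ η / 3 / c ^ p := by
      rw [Measure.real]
      exact ENNReal.toReal_le_of_le_ofReal (by positivity) hK.le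
    rw [le_div_iff₀ (by positivity)] at this
    linarith
  have huc : UniformContinuousOn F (closedBall 0 R) :=
    (isCompact_closedBall (0 : EE n) R).uniformContinuousOn_of_continuous hF.continuousOn
  rw [Metric.uniformContinuousOn_iff] at huc
  obtain ⟨δ1, hδ1, huc⟩ := huc (s / 2) (by positivity)
  obtain ⟨ε, hε, hthick⟩ := hKc.exists_thickening_subset_open hU hKU
  -- mesh h
  obtain ⟨h, hh, hh1, hha, hhb, hhc⟩ : ∃ h : ℝ, 0 < h ∧ h ≤ 1 ∧ (2 * n) * h < δ1 ∧ (2 * n) * h < ε ∧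
      (2 * n) * h ≤ s / 2 := by
    set m := min δ1 (min ε (s / 2)) with hm
    have hm0 : 0 < m := by positivity
    have hn0 : (0 : ℝ) < 2 * n := by positivity
    refine ⟨min 1 (m / (2 * (2 * n))), by positivity, min_le_left _ _, ?_⟩
    have h1 : (2 * n) * min 1 (m / (2 * (2 * n))) ≤ m / 2 := by
      calc (2 * (n : ℝ)) * min 1 (m / (2 * (2 * n))) ≤ (2 * n) * (m / (2 * (2 * n))) := by
            gcongr; exact min_le_right _ _
        _ = m / 2 := by field_simp
    have e1 : m ≤ δ1 := min_le_left _ _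
    have e2 : m ≤ ε := (min_le_right _ _).trans (min_le_left _ _)
    have e3 : m ≤ s / 2 := (min_le_right _ _).trans (min_le_right _ _)
    refine ⟨?_, ?_, ?_⟩ <;> linarith
  obtain ⟨N, hN, M, hM⟩ := approx_cells hn hUf hV hVU hR hUR hFR hθ1 hpush hh hh1 hhc (by
    intro x hx y hy hxy
    have := huc x (by simpa using hUR x hx) y (by simpa using hUR y hy) (by
      rw [dist_eq_norm]; linarith)
    rw [dist_eq_norm] at this
    exact this.le)
  have hcellU : ∀ z, (cell h z ∩ K).Nonempty → cell h z ⊆ U := by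
    rintro z ⟨y, hy, hyK⟩ x hx
    apply hthick
    rw [Metric.mem_thickening_iff]
    exact ⟨y, hyK, by rw [dist_eq_norm]; linarith [cell_dist hx hy]⟩
  set Q : ℝ := |M| + 2 * R with hQ
  have hQ0 : 0 < Q := by positivity
  obtain ⟨δ, hδ0, hδ4, hδ⟩ := exists_delta (2 * n) (h := h)
    (A := Q ^ p * (grid (n := n) N).card) (show 0 < η / 3 by positivity)
  obtain ⟨S, S', hSS, hS⟩ := hM δ hδ0
  refine ⟨S, S', M, hSS, ?_⟩
  set Bad : Set (EE n) := ⋃ z ∈ ((grid N : Finset (Fin n ⊕ Fin n → ℤ)) : Set (Fin n ⊕ Fin n → ℤ)) ∩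
    {z | ¬ Good h θ V z}, U ∩ cell h z with hBad
  set W : Set (EE n) := ⋃ z ∈ grid N, (cell h z \ stile h δ z) with hW
  have hBadv := bad_measure hUf hV hh hθ0 (grid N) hcellU
  have hWm : MeasurableSet W :=
    Finset.measurableSet_biUnion _ fun z _ => (measurableSet_cell h z).diff (measurableSet_stile h δ z)
  have hBadm : MeasurableSet Bad := by
    refine MeasurableSet.biUnion (Set.Finite.countable ?_) fun z _ => hU.measurableSet.inter (measurableSet_cell h z)
    exact (Finset.finite_toSet _).subset Set.inter_subset_left
  have hWv : volume.real W ≤ (grid (n := n) N).card * (h ^ (2 * n) - (h * (1 - 2 * δ)) ^ (2 * n)) := by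
    refine (measureReal_biUnion_finset_le _ _).trans ?_
    rw [Finset.sum_congr rfl fun z _ => volumeReal_cell_diff hh hδ0 (by linarith) z,
      Finset.sum_const, nsmul_eq_mul]
  have hWf : volume W ≠ ⊤ := by
    refine (measure_biUnion_lt_top (Finset.finite_toSet _) fun z _ => ?_).ne
    exact lt_of_le_of_lt (measure_mono Set.sdiff_subset) (cell_ne_top hh z).lt_top
  have hBadU : Bad ⊆ U := by
    intro x hx
    simp only [hBad, Set.mem_iUnion] at hx
    obtain ⟨z, _, hx⟩ := hx
    exact hx.1
  have hBadf : volume Bad ≠ ⊤ := ne_top_of_le_ne_top hUf (measure_mono hBadU)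
  have hpt : ∀ x ∈ U, ‖F x - S x‖ ^ p ≤
      s ^ p + Bad.indicator (fun _ => c ^ p) x + W.indicator (fun _ => Q ^ p) x := by
    intro x hx
    have i1 : 0 ≤ Bad.indicator (fun _ => c ^ p) x :=
      Set.indicator_nonneg (fun _ _ => by positivity) x
    have i2 : 0 ≤ W.indicator (fun _ => Q ^ p) x :=
      Set.indicator_nonneg (fun _ _ => by positivity) x
    have i3 : 0 < s ^ p := by positivity
    by_cases hxW : x ∈ W
    · rw [Set.indicator_of_mem hxW]
      have : ‖F x - S x‖ ≤ Q := by
        calc ‖F x - S x‖ = ‖F x - x - (S x - x)‖ := by congr 1; abel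
          _ ≤ ‖F x‖ + ‖x‖ + ‖S x - x‖ := (norm_sub_le _ _).trans (by gcongr; exact norm_sub_le _ _)
          _ ≤ R + R + |M| := by
            gcongr; exacts [hFR x hx, hUR x hx, (hSS.2.2.2.2 x).trans (le_abs_self M)]
          _ = _ := by rw [hQ]; ring
      have := Real.rpow_le_rpow (norm_nonneg _) this hp0.le
      linarith
    obtain ⟨z, hz, hxz⟩ := exists_mem_grid hh hN (hUR x hx)
    have hxs : x ∈ stile h δ z := by
      by_contra hcon
      apply hxW
      simp only [hW, Set.mem_iUnion]
      exact ⟨z, hz, hxz, hcon⟩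
    have hSz := hS z hz x hx hxs
    by_cases hg : Good h θ V z
    · have := Real.rpow_le_rpow (norm_nonneg _) (hSz.1 hg) hp0.le
      linarith
    · have hxB : x ∈ Bad := by
        simp only [hBad, Set.mem_iUnion]
        exact ⟨z, ⟨hz, hg⟩, hx, hxz⟩
      rw [Set.indicator_of_mem hxB]
      have := Real.rpow_le_rpow (norm_nonneg _) (hSz.2 hg) hp0.le
      linarith
  have : IsFiniteMeasure (volume.restrict U) := ⟨by simpa using hUf.lt_top⟩
  have I1 : Integrable (fun x : EE n => s ^ p) (volume.restrict U) := integrable_const _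
  have I2 : Integrable (Bad.indicator (fun _ : EE n => c ^ p)) (volume.restrict U) :=
    (integrable_const _).indicator hBadm
  have I3 : Integrable (W.indicator (fun _ : EE n => Q ^ p)) (volume.restrict U) :=
    (integrable_const _).indicator hWm
  have J2 : ∫ x in U, Bad.indicator (fun _ : EE n => c ^ p) x ≤ c ^ p * volume.real Bad := by
    rw [integral_indicator_const _ hBadm, smul_eq_mul, mul_comm, measureReal_restrict_apply hBadm]
    gcongr
    exact Set.inter_subset_left
  have J3 : ∫ x in U, W.indicator (fun _ : EE n => Q ^ p) x ≤ Q ^ p * volume.real W := by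
    rw [integral_indicator_const _ hWm, smul_eq_mul, mul_comm, measureReal_restrict_apply hWm]
    gcongr
    exact Set.inter_subset_left
  calc ∫ x in U, ‖F x - S x‖ ^ p
      ≤ ∫ x in U, (s ^ p + Bad.indicator (fun _ => c ^ p) x + W.indicator (fun _ => Q ^ p) x) := by
        apply integral_mono_of_nonneg
        · exact Filter.Eventually.of_forall fun x => by positivity
        · exact (I1.add I2).add I3
        · exact (ae_restrict_iff' hU.measurableSet).2 (Filter.Eventually.of_forall hpt)
    _ = (∫ x in U, s ^ p) + (∫ x in U, Bad.indicator (fun _ => c ^ p) x) +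
          ∫ x in U, W.indicator (fun _ => Q ^ p) x := by
        rw [← integral_add I1 I2]
        exact integral_add (I1.add I2) I3
    _ ≤ s ^ p * vU + c ^ p * volume.real Bad + Q ^ p * volume.real W := by
        gcongr
        rw [setIntegral_const, smul_eq_mul, mul_comm]
    _ ≤ s ^ p * vU + c ^ p * (volume.real (U \ K) + θ⁻¹ * volume.real (U \ V)) +
        Q ^ p * ((grid (n := n) N).card * (h ^ (2 * n) - (h * (1 - 2 * δ)) ^ (2 * n))) := by
        gcongr
    _ ≤ _ := by nlinarith


def rayInt {n : ℕ} (e : EE n) (g : EE n → ℝ) (y : EE n) : ℝ := ∫ s in Set.Ioi (0 : ℝ), g (y - s • e)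

theorem isClosedEmbedding_ray {n : ℕ} {e : EE n} (he : ‖e‖ = 1) :
    Topology.IsClosedEmbedding (fun s : ℝ => s • e) := by
  have : Isometry (fun s : ℝ => s • e) := by
    apply Isometry.of_dist_eq
    intro a b
    rw [dist_eq_norm, ← sub_smul, norm_smul, he, mul_one, Real.dist_eq, Real.norm_eq_abs]
  exact this.isClosedEmbedding

theorem rayInt_contDiff {n : ℕ} {e : EE n} (he : ‖e‖ = 1) {g : EE n → ℝ} (hg : ContDiff ℝ 1 g)
    (hgc : HasCompactSupport g) : ContDiff ℝ 1 (rayInt e g) := by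
  set μ : Measure (EE n) := Measure.map (fun s : ℝ => s • e) (volume.restrict (Set.Ioi 0)) with hμ
  have hemb := (isClosedEmbedding_ray he).measurableEmbedding
  have hloc : LocallyIntegrable (fun _ : EE n => (1 : ℝ)) μ := by
    have hfin : IsFiniteMeasureOnCompacts μ := by
      constructor
      intro K hK
      rw [hμ, hemb.map_apply]
      have : IsCompact ((fun s : ℝ => s • e) ⁻¹' K) := (isClosedEmbedding_ray he).isCompact_preimage hK
      exact lt_of_le_of_lt (Measure.restrict_apply_le _ _) this.measure_lt_top
    exact locallyIntegrable_const _
  have h1 := hgc.contDiff_convolution_right (ContinuousLinearMap.lsmul ℝ ℝ) (n := 1) hloc (by exact_mod_cast hg)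
  have h2 : convolution (fun _ : EE n => (1 : ℝ)) g (ContinuousLinearMap.lsmul ℝ ℝ) μ = rayInt e g := by
    funext y
    rw [convolution, hμ, hemb.integral_map]
    simp [rayInt]
  rw [h2] at h1
  exact_mod_cast h1

theorem rayInt_shift {n : ℕ} (e : EE n) (g : EE n → ℝ) (y : EE n) (τ : ℝ) :
    rayInt e g (y + τ • e) = ∫ s in Set.Iic τ, g (y + s • e) := by
  rw [integral_Iic_eq_integral_Iio, rayInt, ← integral_indicator measurableSet_Ioi,
    ← integral_indicator measurableSet_Iio,
    ← integral_sub_left_eq_self (fun s => (Set.Iio τ).indicator (fun s => g (y + s • e)) s) volume τ]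
  congr 1
  funext s
  by_cases hs : 0 < s
  · rw [Set.indicator_of_mem (show s ∈ Set.Ioi 0 from hs),
      Set.indicator_of_mem (show τ - s ∈ Set.Iio τ by simp [hs])]
    congr 1
    module
  · rw [Set.indicator_of_notMem (show s ∉ Set.Ioi 0 from hs),
      Set.indicator_of_notMem (show τ - s ∉ Set.Iio τ by simpa using hs)]

theorem line_integrable {n : ℕ} {e : EE n} (he : ‖e‖ = 1) {g : EE n → ℝ} (hg : Continuous g)
    (hgc : HasCompactSupport g) (y : EE n) : Integrable (fun s : ℝ => g (y + s • e)) := by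
  have hc : Continuous fun s : ℝ => g (y + s • e) := by fun_prop
  apply hc.integrable_of_hasCompactSupport
  have : Topology.IsClosedEmbedding (fun s : ℝ => y + s • e) :=
    (Homeomorph.addLeft y).isClosedEmbedding.comp (isClosedEmbedding_ray he)
  exact hgc.comp_isClosedEmbedding this

theorem rayInt_hasDerivAt {n : ℕ} {e : EE n} (he : ‖e‖ = 1) {g : EE n → ℝ} (hg : Continuous g)
    (hgc : HasCompactSupport g) (y : EE n) (τ : ℝ) :
    HasDerivAt (fun t : ℝ => rayInt e g (y + t • e)) (g (y + τ • e)) τ := by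
  have hI := line_integrable he hg hgc y
  have hc : Continuous fun s : ℝ => g (y + s • e) := by fun_prop
  have h1 : (fun t : ℝ => rayInt e g (y + t • e)) =
      fun t => (∫ s in Set.Iic (0 : ℝ), g (y + s • e)) + ∫ s in (0 : ℝ)..t, g (y + s • e) := by
    funext t
    rw [rayInt_shift, ← intervalIntegral.integral_Iic_sub_Iic hI.integrableOn hI.integrableOn]
    ring
  rw [h1]
  exact (intervalIntegral.integral_hasDerivAt_right (hc.intervalIntegrable _ _)
    (hc.stronglyMeasurableAtFilter _ _) hc.continuousAt).const_add _

theorem rayInt_fderiv {n : ℕ} {e : EE n} (he : ‖e‖ = 1) {g : EE n → ℝ} (hg : ContDiff ℝ 1 g)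
    (hgc : HasCompactSupport g) (y : EE n) : fderiv ℝ (rayInt e g) y e = g y := by
  have h1 := ((rayInt_contDiff he hg hgc).differentiable one_ne_zero y).hasFDerivAt
  have h2 := rayInt_hasDerivAt he hg.continuous hgc y 0
  simp only [zero_smul, add_zero] at h2
  have h3 : HasDerivAt (fun t : ℝ => y + t • e) e 0 := by
    simpa using ((hasDerivAt_id (0 : ℝ)).smul_const e).const_add y
  have h4 : HasFDerivAt (rayInt e g) (fderiv ℝ (rayInt e g) y) (y + (0 : ℝ) • e) := by simpa using h1
  have h5 := h4.comp_hasDerivAt (0 : ℝ) h3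
  exact h5.unique h2

theorem rayInt_mono {n : ℕ} {e : EE n} (he : ‖e‖ = 1) {g : EE n → ℝ} (hg : Continuous g)
    (hgc : HasCompactSupport g) (hg0 : ∀ y, 0 ≤ g y) (y : EE n) {τ : ℝ} (hτ : 0 ≤ τ) :
    rayInt e g y ≤ rayInt e g (y + τ • e) := by
  have : Monotone (fun t : ℝ => rayInt e g (y + t • e)) := by
    apply monotone_of_hasDerivAt_nonneg (fun t => rayInt_hasDerivAt he hg hgc y t)
    intro t; exact hg0 _
  simpa using this hτ

def Tmap {n : ℕ} (e : EE n) (g : EE n → ℝ) (y : EE n) : EE n := y + rayInt e g y • e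

theorem Tmap_injective {n : ℕ} {e : EE n} (he : ‖e‖ = 1) {g : EE n → ℝ} (hg : Continuous g)
    (hgc : HasCompactSupport g) (hg0 : ∀ y, 0 ≤ g y) : Function.Injective (Tmap e g) := by
  have key : ∀ y y', Tmap e g y = Tmap e g y' → rayInt e g y' ≤ rayInt e g y → y = y' := by
    intro y y' h hle
    have h1 : y' = y + (rayInt e g y - rayInt e g y') • e := by
      unfold Tmap at h
      rw [sub_smul, add_sub, h]; abel
    have h2 := rayInt_mono he hg hgc hg0 y (sub_nonneg.2 hle)
    rw [← h1] at h2
    have : rayInt e g y - rayInt e g y' = 0 := by linarith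
    rw [this] at h1
    simpa using h1.symm
  intro y y' h
  rcases le_total (rayInt e g y') (rayInt e g y) with hle | hle
  · exact key y y' h hle
  · exact (key y' y h.symm hle).symm

theorem Tmap_hasFDerivAt {n : ℕ} {e : EE n} (he : ‖e‖ = 1) {g : EE n → ℝ} (hg : ContDiff ℝ 1 g)
    (hgc : HasCompactSupport g) (y : EE n) :
    ∃ L : EE n →L[ℝ] EE n, HasFDerivAt (Tmap e g) L y ∧ L.det = 1 + g y := by
  have h1 := ((rayInt_contDiff he hg hgc).differentiable one_ne_zero y).hasFDerivAt
  refine ⟨ContinuousLinearMap.id ℝ (EE n) + (fderiv ℝ (rayInt e g) y).smulRight e,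
    (hasFDerivAt_id y).add (h1.smul_const e), ?_⟩
  rw [← rayInt_fderiv he hg hgc y]
  have := LinearMap.transvection.det (fderiv ℝ (rayInt e g) y).toLinearMap e
  rw [ContinuousLinearMap.det]
  exact this


theorem rayInt_eq {n : ℕ} {e : EE n} (he : ‖e‖ = 1) {g : EE n → ℝ} {P : Set (EE n)} {d r : ℝ}
    (hP : ∀ y ∈ P, ∀ w ∈ P, dist y w ≤ d)
    (hsupp : ∀ y, g y ≠ 0 → ∃ w ∈ P, dist y w ≤ r) {y : EE n} (hy : y ∈ P) :
    rayInt e g y = ∫ s in Set.Ioc (0 : ℝ) (d + r), g (y - s • e) := by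
  rw [rayInt]
  apply setIntegral_eq_of_subset_of_forall_sdiff_eq_zero measurableSet_Ioi Set.Ioc_subset_Ioi_self
  intro s hs
  by_contra hne
  obtain ⟨w, hw, hd⟩ := hsupp _ hne
  apply hs.2
  refine ⟨hs.1, ?_⟩
  have hs0 : 0 < s := hs.1
  have h1 : dist y (y - s • e) = s := by
    rw [dist_eq_norm, sub_sub_cancel, norm_smul, he, mul_one, Real.norm_eq_abs, abs_of_pos hs0]
  have h2 := dist_triangle y w (y - s • e)
  rw [dist_comm w] at h2
  have := hP y hy w hw
  linarith

theorem rayInt_nonneg {n : ℕ} {e : EE n} {g : EE n → ℝ} (hg0 : ∀ y, 0 ≤ g y) (y : EE n) :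
    0 ≤ rayInt e g y := integral_nonneg fun _ => hg0 _

theorem rayInt_le {n : ℕ} {e : EE n} (he : ‖e‖ = 1) {g : EE n → ℝ} {P : Set (EE n)} {d r B : ℝ}
    (hP : ∀ y ∈ P, ∀ w ∈ P, dist y w ≤ d) (hdr : 0 ≤ d + r)
    (hsupp : ∀ y, g y ≠ 0 → ∃ w ∈ P, dist y w ≤ r) (hg0 : ∀ y, 0 ≤ g y) (hB : ∀ y, g y ≤ B)
    {y : EE n} (hy : y ∈ P) :
    rayInt e g y ≤ (d + r) * B := by
  rw [rayInt_eq he hP hsupp hy]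
  calc _ ≤ ∫ s in Set.Ioc (0 : ℝ) (d + r), B := by
        apply integral_mono_of_nonneg
        · exact Filter.Eventually.of_forall fun _ => hg0 _
        · exact integrable_const _
        · exact Filter.Eventually.of_forall fun _ => hB _
    _ = _ := by
        rw [setIntegral_const, smul_eq_mul, Real.volume_real_Ioc_of_le hdr]
        simp

theorem rayInt_rpow_le {n : ℕ} {e : EE n} (he : ‖e‖ = 1) {g : EE n → ℝ} (hg : Continuous g)
    {P : Set (EE n)} {d r : ℝ}
    (hP : ∀ y ∈ P, ∀ w ∈ P, dist y w ≤ d) (hdr : 0 < d + r)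
    (hsupp : ∀ y, g y ≠ 0 → ∃ w ∈ P, dist y w ≤ r) (hg0 : ∀ y, 0 ≤ g y)
    {p : ℝ} (hp : 1 ≤ p) {y : EE n} (hy : y ∈ P) :
    ENNReal.ofReal (rayInt e g y ^ p) ≤ ENNReal.ofReal ((d + r) ^ (p - 1)) *
      ∫⁻ s in Set.Ioc (0 : ℝ) (d + r), ENNReal.ofReal (g (y - s • e) ^ p) := by
  have hp0 : 0 < p := by linarith
  set I := Set.Ioc (0 : ℝ) (d + r)
  have hc : Continuous fun s : ℝ => g (y - s • e) := by fun_prop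
  have h1 := eLpNorm'_le_eLpNorm'_mul_rpow_measure_univ (f := fun s : ℝ => g (y - s • e))
    (p := 1) (q := p) one_pos hp (μ := volume.restrict I) hc.aestronglyMeasurable
  simp only [eLpNorm', div_one, ENNReal.rpow_one, Measure.restrict_apply_univ] at h1
  have hvol : volume I = ENNReal.ofReal (d + r) := by simp [I]
  have e1 : ∀ s : ℝ, ‖g (y - s • e)‖ₑ = ENNReal.ofReal (g (y - s • e)) := fun s =>
    Real.enorm_eq_ofReal (hg0 _)
  have e2 : ∀ s : ℝ, ‖g (y - s • e)‖ₑ ^ p = ENNReal.ofReal (g (y - s • e) ^ p) := fun s => by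
    rw [e1, ENNReal.ofReal_rpow_of_nonneg (hg0 _) hp0.le]
  have e3 : ENNReal.ofReal (rayInt e g y) ≤ ∫⁻ s in I, ‖g (y - s • e)‖ₑ := by
    rw [rayInt_eq he hP hsupp hy]
    refine (ENNReal.ofReal_le_ofReal (le_abs_self _)).trans ?_
    rw [← Real.enorm_eq_ofReal_abs]
    exact enorm_integral_le_lintegral_enorm _
  have h2 := ENNReal.rpow_le_rpow (e3.trans h1) hp0.le
  rw [ENNReal.mul_rpow_of_nonneg _ _ hp0.le, ← ENNReal.rpow_mul, ← ENNReal.rpow_mul,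
    one_div_mul_cancel hp0.ne', ENNReal.rpow_one, hvol, ENNReal.ofReal_rpow_of_nonneg (rayInt_nonneg hg0 y) hp0.le] at h2
  have e4 : (1 - 1 / p) * p = p - 1 := by field_simp
  simp only [e2] at h2
  rw [e4, ENNReal.ofReal_rpow_of_pos hdr, mul_comm] at h2
  exact h2

theorem cost_le {n : ℕ} {e : EE n} (he : ‖e‖ = 1) {g : EE n → ℝ} (hg : ContDiff ℝ 1 g)
    (hgc : HasCompactSupport g) {U : Set (EE n)} (hU : MeasurableSet U) {u : EE n → EE n}
    (hu : Measurable u) {d r : ℝ}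
    (hP : ∀ y ∈ u '' U, ∀ w ∈ u '' U, dist y w ≤ d) (hdr : 0 < d + r)
    (hsupp : ∀ y, g y ≠ 0 → ∃ w ∈ u '' U, dist y w ≤ r) (hg0 : ∀ y, 0 ≤ g y)
    {p : ℝ} (hp : 1 ≤ p) {κ : ℝ} (hκ : 0 ≤ κ)
    (hpush : ∀ H : EE n → ENNReal, Measurable H → ∫⁻ x in U, H (u x) ≤ ENNReal.ofReal κ * ∫⁻ y, H y) :
    ∫ x in U, rayInt e g (u x) ^ p ≤ κ * (d + r) ^ p * ∫ y, g y ^ p := by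
  have hp0 : 0 < p := by linarith
  have hcontp : Continuous fun y => g y ^ p := hg.continuous.rpow_const fun _ => Or.inr hp0.le
  have hgpI : Integrable fun y => g y ^ p := by
    apply hcontp.integrable_of_hasCompactSupport
    have := hgc.comp_left (g := fun t : ℝ => t ^ p) (Real.zero_rpow hp0.ne')
    exact this
  have hR0 : 0 ≤ κ * (d + r) ^ p * ∫ y, g y ^ p := by
    have : 0 ≤ ∫ y, g y ^ p := integral_nonneg fun y => Real.rpow_nonneg (hg0 y) p
    positivity
  have hcR : Continuous (rayInt e g) := (rayInt_contDiff he hg hgc).continuous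
  have hmeas : Measurable fun x => rayInt e g (u x) ^ p :=
    ((hcR.measurable.comp hu).pow_const p)
  rw [integral_eq_lintegral_of_nonneg_ae (Filter.Eventually.of_forall fun x =>
    Real.rpow_nonneg (rayInt_nonneg hg0 _) p) hmeas.aestronglyMeasurable]
  apply ENNReal.toReal_le_of_le_ofReal hR0
  calc ∫⁻ x in U, ENNReal.ofReal (rayInt e g (u x) ^ p)
      ≤ ∫⁻ x in U, ENNReal.ofReal ((d + r) ^ (p - 1)) *
          ∫⁻ s in Set.Ioc (0 : ℝ) (d + r), ENNReal.ofReal (g (u x - s • e) ^ p) := by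
        apply setLIntegral_mono' hU
        intro x hx
        exact rayInt_rpow_le he hg.continuous hP hdr hsupp hg0 hp (Set.mem_image_of_mem u hx)
    _ = ENNReal.ofReal ((d + r) ^ (p - 1)) * ∫⁻ x in U,
          ∫⁻ s in Set.Ioc (0 : ℝ) (d + r), ENNReal.ofReal (g (u x - s • e) ^ p) := by
        rw [lintegral_const_mul' _ _ ENNReal.ofReal_ne_top]
    _ = ENNReal.ofReal ((d + r) ^ (p - 1)) * ∫⁻ s in Set.Ioc (0 : ℝ) (d + r),
          ∫⁻ x in U, ENNReal.ofReal (g (u x - s • e) ^ p) := by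
        congr 1
        apply lintegral_lintegral_swap
        apply Measurable.aemeasurable
        apply ENNReal.measurable_ofReal.comp
        apply hcontp.measurable.comp
        exact (hu.comp measurable_fst).sub (measurable_snd.smul_const e)
    _ ≤ ENNReal.ofReal ((d + r) ^ (p - 1)) * ∫⁻ s in Set.Ioc (0 : ℝ) (d + r),
          (ENNReal.ofReal κ * ∫⁻ y, ENNReal.ofReal (g y ^ p)) := by
        gcongr with s
        have h1 := hpush (fun y => ENNReal.ofReal (g (y - s • e) ^ p)) (by
          apply ENNReal.measurable_ofReal.comp
          apply hcontp.measurable.comp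
          exact measurable_id.sub_const _)
        refine h1.trans (le_of_eq ?_)
        rw [lintegral_sub_right_eq_self (fun y => ENNReal.ofReal (g y ^ p)) (s • e)]
    _ = ENNReal.ofReal (κ * (d + r) ^ p * ∫ y, g y ^ p) := by
        rw [setLIntegral_const, Real.volume_Ioc, sub_zero,
          ← ofReal_integral_eq_lintegral_ofReal hgpI (Filter.Eventually.of_forall fun y =>
            Real.rpow_nonneg (hg0 y) p), ← ENNReal.ofReal_mul hκ, ← ENNReal.ofReal_mul' hdr.le,
          ← ENNReal.ofReal_mul (by positivity)]
        congr 1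
        have : (d + r) ^ p = (d + r) ^ (p - 1) * (d + r) := by
          rw [← Real.rpow_add_one hdr.ne']; simp
        rw [this]; ring


theorem mollify {n : ℕ} {G : EE n → ℝ} (hG : Measurable G) (h0 : ∀ y, 0 ≤ G y) {B : ℝ}
    (hB : ∀ y, G y ≤ B) {P : Set (EE n)} (hP : IsBounded P) (hsupp : ∀ y, G y ≠ 0 → y ∈ P)
    {p : ℝ} (hp : 1 ≤ p) {r ε κ : ℝ} (hr : 0 < r) (hε : 0 < ε) (hκ : 0 < κ) :
    ∃ g : EE n → ℝ, ContDiff ℝ 1 g ∧ HasCompactSupport g ∧ (∀ y, 0 ≤ g y) ∧ (∀ y, g y ≤ B) ∧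
      (∀ y, g y ≠ 0 → ∃ w ∈ P, dist y w ≤ r) ∧ (∫ y, g y ^ p ≤ (∫ y, G y ^ p) + ε) ∧
      volume {y | g y < G y - κ} ≤ ENNReal.ofReal ε := by
  have hp0 : 0 < p := by linarith
  have hB0 : 0 ≤ B := (h0 0).trans (hB 0)
  obtain ⟨ρ, hρ⟩ := hP.subset_closedBall (0 : EE n)
  let φ : ℕ → ContDiffBump (0 : EE n) := fun k =>
    ⟨1 / ((k : ℝ) + 1) / 2, 1 / ((k : ℝ) + 1), by positivity, by
      have : 0 < 1 / ((k : ℝ) + 1) := by positivity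
      linarith⟩
  have hφr : ∀ k, (φ k).rOut = 1 / ((k : ℝ) + 1) := fun k => rfl
  have hφi : ∀ k, (φ k).rIn = 1 / ((k : ℝ) + 1) / 2 := fun k => rfl
  have hφt : Filter.Tendsto (fun k => (φ k).rOut) Filter.atTop (nhds 0) :=
    tendsto_one_div_add_atTop_nhds_zero_nat
  have hφ1 : ∀ k, (φ k).rOut ≤ 1 := by
    intro k
    rw [hφr, div_le_one (by positivity)]
    have : (0 : ℝ) ≤ k := by positivity
    linarith
  have hGc : HasCompactSupport G := by
    apply HasCompactSupport.of_support_subset_isCompact (isCompact_closedBall (0 : EE n) ρ)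
    intro y hy
    exact hρ (hsupp y hy)
  have hGI : Integrable G := by
    have : Integrable ((closedBall (0 : EE n) ρ).indicator fun _ => B) :=
      (integrable_indicator_iff measurableSet_closedBall).2
        (integrableOn_const (by exact measure_closedBall_lt_top.ne))
    apply this.mono' hG.aestronglyMeasurable
    refine Filter.Eventually.of_forall fun y => ?_
    rw [Real.norm_eq_abs, abs_of_nonneg (h0 y)]
    by_cases hy : G y = 0
    · rw [hy]; exact Set.indicator_nonneg (fun _ _ => hB0) y
    · rw [Set.indicator_of_mem (hρ (hsupp y hy))]; exact hB y
  let gk : ℕ → EE n → ℝ := fun k =>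
    convolution ((φ k).normed volume) G (ContinuousLinearMap.lsmul ℝ ℝ) volume
  have hgk : ∀ k y, gk k y = ∫ t, (φ k).normed volume t * G (y - t) := fun k y => rfl
  have hae : ∀ᵐ y, Filter.Tendsto (fun k => gk k y) Filter.atTop (nhds (G y)) :=
    ContDiffBump.ae_convolution_tendsto_right_of_locallyIntegrable (K := 2) hφt
      (Filter.Eventually.of_forall fun k => by rw [hφi, hφr]; linarith) hGI.locallyIntegrable
  have hcd : ∀ k, ContDiff ℝ 1 (gk k) := by
    intro k
    have := (φ k).hasCompactSupport_normed.contDiff_convolution_left (ContinuousLinearMap.lsmul ℝ ℝ)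
      (n := 1) (μ := (volume : Measure (EE n))) ((φ k).contDiff_normed (μ := volume)) hGI.locallyIntegrable
    exact_mod_cast this
  have hcs : ∀ k, HasCompactSupport (gk k) := fun k =>
    HasCompactSupport.convolution _ (φ k).hasCompactSupport_normed hGc
  have hnn : ∀ k y, 0 ≤ gk k y := fun k y =>
    integral_nonneg fun t => mul_nonneg ((φ k).nonneg_normed t) (h0 _)
  have hle : ∀ k y, gk k y ≤ B := by
    intro k y
    rw [hgk]
    calc _ ≤ ∫ t, (φ k).normed volume t * B := by
          apply integral_mono_of_nonneg
          · exact Filter.Eventually.of_forall fun t => mul_nonneg ((φ k).nonneg_normed t) (h0 _)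
          · exact ((φ k).integrable_normed).mul_const B
          · exact Filter.Eventually.of_forall fun t =>
              mul_le_mul_of_nonneg_left (hB _) ((φ k).nonneg_normed t)
      _ = B := by rw [integral_mul_const, (φ k).integral_normed, one_mul]
  have hnear : ∀ k y, gk k y ≠ 0 → ∃ w ∈ P, dist y w ≤ (φ k).rOut := by
    intro k y hne
    by_contra hcon
    push Not at hcon
    apply hne
    rw [hgk]
    have : ∀ t, (φ k).normed volume t * G (y - t) = 0 := by
      intro t
      by_contra ht
      have h1 : (φ k).normed volume t ≠ 0 := left_ne_zero_of_mul ht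
      have h2 : G (y - t) ≠ 0 := right_ne_zero_of_mul ht
      have h3 : t ∈ Function.support ((φ k).normed volume) := h1
      rw [(φ k).support_normed_eq, mem_ball_zero_iff] at h3
      have h4 := hcon _ (hsupp _ h2)
      rw [dist_eq_norm, sub_sub_cancel] at h4
      linarith
    simp [this]
  -- convergence of integrals
  set bd : EE n → ℝ := (closedBall (0 : EE n) (ρ + 1)).indicator fun _ => B ^ p with hbd
  have hbdI : Integrable bd :=
    (integrable_indicator_iff measurableSet_closedBall).2
      (integrableOn_const (by exact measure_closedBall_lt_top.ne))
  have hlim : Filter.Tendsto (fun k => ∫ y, gk k y ^ p) Filter.atTop (nhds (∫ y, G y ^ p)) := by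
    apply tendsto_integral_of_dominated_convergence bd
    · intro k
      exact ((hcd k).continuous.measurable.pow_const p).aestronglyMeasurable
    · exact hbdI
    · intro k
      refine Filter.Eventually.of_forall fun y => ?_
      rw [Real.norm_eq_abs, abs_of_nonneg (Real.rpow_nonneg (hnn k y) p)]
      by_cases hy : gk k y = 0
      · rw [hy, Real.zero_rpow hp0.ne']
        exact Set.indicator_nonneg (fun _ _ => by positivity) y
      · obtain ⟨w, hw, hd⟩ := hnear k y hy
        have hw' := hρ hw
        rw [mem_closedBall] at hw'
        have : y ∈ closedBall (0 : EE n) (ρ + 1) := by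
          rw [mem_closedBall]
          have := dist_triangle y w 0
          linarith [hφ1 k]
        rw [hbd, Set.indicator_of_mem this]
        exact Real.rpow_le_rpow (hnn k y) (hle k y) hp0.le
    · filter_upwards [hae] with y hy
      exact hy.rpow_const (Or.inr hp0.le)
  have hfin : IsFiniteMeasure (volume.restrict (closedBall (0 : EE n) ρ)) :=
    ⟨by rw [Measure.restrict_apply_univ]; exact measure_closedBall_lt_top⟩
  have hmeas := tendstoInMeasure_of_tendsto_ae (μ := volume.restrict (closedBall (0 : EE n) ρ))
    (f := gk) (g := G) (fun k => (hcd k).continuous.aestronglyMeasurable) (ae_restrict_of_ae hae)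
  have hm := hmeas (ENNReal.ofReal κ) (by simpa using hκ)
  have e1 := hlim.eventually (gt_mem_nhds (show ∫ y, G y ^ p < (∫ y, G y ^ p) + ε by linarith))
  have e2 := hm.eventually (gt_mem_nhds (show (0 : ENNReal) < ENNReal.ofReal ε by simpa using hε))
  have e3 := hφt.eventually (gt_mem_nhds hr)
  obtain ⟨k, ⟨hk1, hk2⟩, hk3⟩ := ((e1.and e2).and e3).exists
  refine ⟨gk k, hcd k, hcs k, hnn k, hle k, ?_, hk1.le, ?_⟩
  · intro y hy
    obtain ⟨w, hw, hd⟩ := hnear k y hy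
    exact ⟨w, hw, hd.trans hk3.le⟩
  · refine le_trans ?_ hk2.le
    rw [Measure.restrict_apply' measurableSet_closedBall]
    apply measure_mono
    intro y hy
    have hy' : gk k y < G y - κ := hy
    refine ⟨?_, ?_⟩
    · show ENNReal.ofReal κ ≤ edist (gk k y) (G y)
      rw [edist_dist]
      apply ENNReal.ofReal_le_ofReal
      rw [Real.dist_eq, abs_sub_comm]
      exact (by linarith : κ ≤ G y - gk k y).trans (le_abs_self _)
    · apply hρ
      apply hsupp
      intro hz
      have := hnn k y
      linarith


theorem null_preimage {n : ℕ} {u : EE n → EE n} {s : Set (EE n)} {f' : EE n → EE n →L[ℝ] EE n}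
    (hf : ∀ x ∈ s, HasFDerivWithinAt u (f' x) s x) (hdet : ∀ x ∈ s, (f' x).det ≠ 0)
    {N : Set (EE n)} (hN : volume N = 0) : volume (s ∩ u ⁻¹' N) = 0 := by
  classical
  have key : ∀ A : EE n →L[ℝ] EE n, ∃ δ : NNReal, 0 < δ ∧ (A.det ≠ 0 → ∀ (s : Set (EE n)) (f : EE n → EE n),
      ApproximatesLinearOn f A s δ → ((Real.toNNReal (|A.det| / 2) : NNReal) : ENNReal) * volume s ≤ volume (f '' s)) := by
    intro A
    by_cases hA : A.det = 0
    · exact ⟨1, one_pos, fun h => absurd hA h⟩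
    have hm : ((Real.toNNReal (|A.det| / 2) : NNReal) : ENNReal) < ENNReal.ofReal |A.det| := by
      have : 0 < |A.det| := abs_pos.2 hA
      exact (ENNReal.ofReal_lt_ofReal_iff this).2 (by linarith)
    have h1 := mul_le_addHaar_image_of_lt_det (μ := (volume : Measure (EE n))) A hm
    obtain ⟨δ, h2, h3⟩ := (h1.and self_mem_nhdsWithin).exists
    exact ⟨δ, h3, fun _ => h2⟩
  choose r hr0 hr using key
  obtain ⟨t, A, -, -, hcov, happ, hA⟩ := exists_partition_approximatesLinearOn_of_hasFDerivWithinAt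
    u s f' hf r (fun A => (hr0 A).ne')
  rcases s.eq_empty_or_nonempty with rfl | hne
  · simp
  have hsub : s ∩ u ⁻¹' N ⊆ ⋃ k, (s ∩ t k) ∩ u ⁻¹' N := by
    intro x hx
    obtain ⟨k, hk⟩ := Set.mem_iUnion.1 (hcov hx.1)
    exact Set.mem_iUnion.2 ⟨k, ⟨hx.1, hk⟩, hx.2⟩
  refine measure_mono_null hsub (measure_iUnion_null fun k => ?_)
  obtain ⟨y, hy, hAy⟩ := hA hne k
  have hd : (A k).det ≠ 0 := by rw [hAy]; exact hdet y hy
  have h1 := hr (A k) hd ((s ∩ t k) ∩ u ⁻¹' N) u ((happ k).mono_set Set.inter_subset_left)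
  have h2 : volume (u '' ((s ∩ t k) ∩ u ⁻¹' N)) = 0 := by
    refine measure_mono_null ?_ hN
    rintro _ ⟨x, hx, rfl⟩
    exact hx.2
  rw [h2] at h1
  have h3 := le_antisymm h1 bot_le
  rcases mul_eq_zero.1 h3 with h | h
  · exfalso
    have : 0 < |(A k).det| := abs_pos.2 hd
    simp at h
    linarith
  · exact h

/-- Data of a good full-measure subset. -/
structure GoodSub {n : ℕ} (U U' : Set (EE n)) (u : EE n → EE n) (lam Lam : ℝ) : Prop where
  meas : MeasurableSet U'
  sub : U' ⊆ U
  full : volume (U \ U') = 0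
  inj : Set.InjOn u U'
  diff : ∀ x ∈ U', DifferentiableAt ℝ u x
  lo : ∀ x ∈ U', lam ≤ (fderiv ℝ u x).det
  hi : ∀ x ∈ U', (fderiv ℝ u x).det ≤ Lam

theorem measurable_det_fderiv {n : ℕ} (u : EE n → EE n) :
    Measurable fun x => (fderiv ℝ u x).det :=
  ContinuousLinearMap.continuous_det.measurable.comp (measurable_fderiv ℝ u)

theorem exists_goodSub {n : ℕ} {U : Set (EE n)} (hU : IsOpen U) {u : EE n → EE n}
    (hu : Continuous u) (hm : multOn U u = 1) {lam Lam : ℝ} (hlam : 0 < lam)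
    (hdet : ∀ᵐ x ∂(volume.restrict U), DifferentiableAt ℝ u x ∧
      lam ≤ (fderiv ℝ u x).det ∧ (fderiv ℝ u x).det ≤ Lam) :
    ∃ U', GoodSub U U' u lam Lam := by
  have h1 : ∀ᵐ y : EE n, (U ∩ u ⁻¹' {y}).encard ≤ 1 := by
    have h := ae_le_essSup (f := fun y : EE n => (U ∩ u ⁻¹' {y}).encard) (μ := volume)
    rw [← multOn.eq_1, hm] at h
    exact h
  set N := toMeasurable volume {y : EE n | ¬ (U ∩ u ⁻¹' {y}).encard ≤ 1} with hN
  have hN0 : volume N = 0 := by rw [hN, measure_toMeasurable]; exact h1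
  set D : Set (EE n) := {x | DifferentiableAt ℝ u x} ∩ {x | lam ≤ (fderiv ℝ u x).det} ∩
    {x | (fderiv ℝ u x).det ≤ Lam} with hD
  have hDm : MeasurableSet D :=
    ((measurableSet_of_differentiableAt ℝ u).inter
      (measurableSet_le measurable_const (measurable_det_fderiv u))).inter
      (measurableSet_le (measurable_det_fderiv u) measurable_const)
  have hUD : volume (U \ D) = 0 := by
    rw [ae_restrict_iff' hU.measurableSet] at hdet
    refine measure_mono_null ?_ hdet
    intro x hx hcon
    have := hcon hx.1
    exact hx.2 ⟨⟨this.1, this.2.1⟩, this.2.2⟩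
  have hpre : volume (D ∩ u ⁻¹' N) = 0 :=
    null_preimage (f' := fderiv ℝ u) (fun x hx => hx.1.1.hasFDerivAt.hasFDerivWithinAt)
      (fun x hx => (lt_of_lt_of_le hlam hx.1.2).ne') hN0
  refine ⟨U ∩ (D \ u ⁻¹' N), ⟨?_, Set.inter_subset_left, ?_, ?_, ?_, ?_, ?_⟩⟩
  · exact hU.measurableSet.inter (hDm.diff (hu.measurable (measurableSet_toMeasurable _ _)))
  · refine measure_mono_null ?_ (measure_union_null hUD hpre)
    intro x hx
    by_cases hxD : x ∈ D
    · right
      refine ⟨hxD, ?_⟩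
      by_contra hxN
      exact hx.2 ⟨hx.1, hxD, hxN⟩
    · left; exact ⟨hx.1, hxD⟩
  · intro x hx y hy hxy
    have hxN : u x ∉ {y : EE n | ¬ (U ∩ u ⁻¹' {y}).encard ≤ 1} :=
      fun hc => hx.2.2 (subset_toMeasurable _ _ hc)
    have h2 : (U ∩ u ⁻¹' {u x}).encard ≤ 1 := by simpa using hxN
    exact Set.encard_le_one_iff.1 h2 x y ⟨hx.1, rfl⟩ ⟨hy.1, hxy.symm⟩
  · intro x hx; exact hx.2.1.1.1
  · intro x hx; exact hx.2.1.1.2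
  · intro x hx; exact hx.2.1.2

theorem GoodSub.push {n : ℕ} {U U' : Set (EE n)} {u : EE n → EE n} {lam Lam : ℝ}
    (h : GoodSub U U' u lam Lam) (hlam : 0 < lam) (H : EE n → ENNReal) :
    ∫⁻ x in U, H (u x) ≤ ENNReal.ofReal lam⁻¹ * ∫⁻ y, H y := by
  have hae : U =ᵐ[volume] U' := by
    refine Filter.EventuallyLE.antisymm ?_ (Filter.Eventually.of_forall h.sub)
    exact ae_le_set.2 h.full
  rw [setLIntegral_congr hae]
  have h1 := lintegral_image_eq_lintegral_abs_det_fderiv_mul volume h.meas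
    (fun x hx => (h.diff x hx).hasFDerivAt.hasFDerivWithinAt) h.inj H
  have h2 : ENNReal.ofReal lam * ∫⁻ x in U', H (u x) ≤ ∫⁻ y, H y := by
    calc _ = ∫⁻ x in U', ENNReal.ofReal lam * H (u x) := by
          rw [lintegral_const_mul' _ _ ENNReal.ofReal_ne_top]
      _ ≤ ∫⁻ x in U', ENNReal.ofReal |(fderiv ℝ u x).det| * H (u x) := by
          apply setLIntegral_mono' h.meas
          intro x hx
          gcongr
          exact (h.lo x hx).trans (le_abs_self _)
      _ = _ := h1.symm
      _ ≤ _ := setLIntegral_le_lintegral _ _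
  rw [ENNReal.ofReal_inv_of_pos hlam]
  rw [← ENNReal.mul_le_iff_le_inv (by simpa using hlam) ENNReal.ofReal_ne_top]
  exact h2

theorem push_bound {n : ℕ} {V : Set (EE n)} (hV : MeasurableSet V) {F : EE n → EE n} (hF : Measurable F)
    (hd : ∀ x ∈ V, DifferentiableAt ℝ F x) (hi : Set.InjOn F V) {m : ℝ} (hm0 : 0 < m)
    (hm : ∀ x ∈ V, m ≤ (fderiv ℝ F x).det) {B : Set (EE n)} (hB : MeasurableSet B) (hBf : volume B ≠ ⊤) :
    volume.real (V ∩ F ⁻¹' B) ≤ m⁻¹ * volume.real B := by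
  have hs : MeasurableSet (V ∩ F ⁻¹' B) := hV.inter (hF hB)
  have h1 := lintegral_abs_det_fderiv_eq_addHaar_image volume hs
    (fun x hx => (hd x hx.1).hasFDerivAt.hasFDerivWithinAt) (hi.mono Set.inter_subset_left)
  have h2 : ENNReal.ofReal m * volume (V ∩ F ⁻¹' B) ≤ volume B := by
    calc _ = ∫⁻ x in V ∩ F ⁻¹' B, ENNReal.ofReal m := by rw [setLIntegral_const]
      _ ≤ ∫⁻ x in V ∩ F ⁻¹' B, ENNReal.ofReal |(fderiv ℝ F x).det| := by
          apply setLIntegral_mono' hs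
          intro x hx
          gcongr
          exact (hm x hx.1).trans (le_abs_self _)
      _ = _ := h1
      _ ≤ _ := by
          apply measure_mono
          rintro _ ⟨x, hx, rfl⟩
          exact hx.2
  rw [le_inv_mul_iff₀ hm0]
  have h3 := ENNReal.toReal_mono hBf h2
  rw [ENNReal.toReal_mul, ENNReal.toReal_ofReal hm0.le] at h3
  exact h3


theorem add_rpow_le_two {a b p : ℝ} (ha : 0 ≤ a) (hb : 0 ≤ b) (hp : 1 ≤ p) :
    (a + b) ^ p ≤ 2 ^ p * (a ^ p + b ^ p) := by
  have h0 : 0 ≤ p := by linarith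
  have hA : 0 ≤ a ^ p := Real.rpow_nonneg ha p
  have hB : 0 ≤ b ^ p := Real.rpow_nonneg hb p
  have h2 : (0:ℝ) ≤ 2 ^ p := Real.rpow_nonneg (by norm_num) p
  rcases le_total a b with h | h
  · calc (a + b) ^ p ≤ (2 * b) ^ p := Real.rpow_le_rpow (by positivity) (by linarith) h0
      _ = 2 ^ p * b ^ p := Real.mul_rpow (by norm_num) hb
      _ ≤ _ := by apply mul_le_mul_of_nonneg_left _ h2; linarith
  · calc (a + b) ^ p ≤ (2 * a) ^ p := Real.rpow_le_rpow (by positivity) (by linarith) h0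
      _ = 2 ^ p * a ^ p := Real.mul_rpow (by norm_num) ha
      _ ≤ _ := by apply mul_le_mul_of_nonneg_left _ h2; linarith

theorem point_bound {a lam Lam c p : ℝ} (hlam : 0 < lam) (h1 : lam ≤ a) (h2 : a ≤ Lam) (hc : 0 < c)
    (hp : 1 ≤ p) :
    a * (max 0 (a⁻¹ - 1) + c) ^ p ≤
      2 ^ p * (lam ^ (1 - p) * (max 0 (1 - a)) ^ p) + 2 ^ p * (Lam * c ^ p) := by
  have ha : 0 < a := lt_of_lt_of_le hlam h1
  have hm : max 0 (a⁻¹ - 1) = a⁻¹ * max 0 (1 - a) := by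
    rw [mul_max_of_nonneg _ _ (inv_nonneg.2 ha.le)]
    congr 1
    · simp
    · field_simp
  have h2p : (0:ℝ) ≤ 2 ^ p := Real.rpow_nonneg (by norm_num) p
  have hM : (0:ℝ) ≤ max 0 (1 - a) := le_max_left _ _
  have hMp : (0:ℝ) ≤ (max 0 (1 - a)) ^ p := Real.rpow_nonneg hM p
  have hcp : (0:ℝ) ≤ c ^ p := Real.rpow_nonneg hc.le p
  calc a * (max 0 (a⁻¹ - 1) + c) ^ p
      ≤ a * (2 ^ p * ((max 0 (a⁻¹ - 1)) ^ p + c ^ p)) :=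
        mul_le_mul_of_nonneg_left (add_rpow_le_two (le_max_left _ _) hc.le hp) ha.le
    _ = 2 ^ p * (a * (max 0 (a⁻¹ - 1)) ^ p) + 2 ^ p * (a * c ^ p) := by ring
    _ ≤ _ := by
      have hcc : 2 ^ p * (a * c ^ p) ≤ 2 ^ p * (Lam * c ^ p) := by gcongr
      refine add_le_add (mul_le_mul_of_nonneg_left ?_ h2p) hcc
      rw [hm, Real.mul_rpow (inv_nonneg.2 ha.le) hM, ← mul_assoc, Real.inv_rpow ha.le,
        ← Real.rpow_neg ha.le]
      have : a * a ^ (-p) = a ^ (1 - p) := by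
        rw [sub_eq_add_neg, Real.rpow_add ha, Real.rpow_one]
      rw [this]
      gcongr ?_ * _
      exact Real.rpow_le_rpow_of_nonpos hlam h1 (by linarith)

theorem GoodSub.E_int {n : ℕ} {U U' : Set (EE n)} {u : EE n → EE n} {lam Lam : ℝ}
    (h : GoodSub U U' u lam Lam) (hlam : 0 < lam) (hUb : IsBounded U) {p : ℝ} (hp : 1 ≤ p) :
    IntegrableOn (fun x => (max 0 (1 - (fderiv ℝ u x).det)) ^ p) U' := by
  have hfin : volume U' < ⊤ := (hUb.subset h.sub).measure_lt_top
  refine Measure.integrableOn_of_bounded (M := 1) hfin.ne ?_ ?_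
  · exact ((measurable_const.max (measurable_const.sub (measurable_det_fderiv u))).pow_const p).aestronglyMeasurable
  · refine (ae_restrict_iff' h.meas).2 (Filter.Eventually.of_forall fun x hx => ?_)
    have hM : (0:ℝ) ≤ max 0 (1 - (fderiv ℝ u x).det) := le_max_left _ _
    rw [Real.norm_eq_abs, abs_of_nonneg (Real.rpow_nonneg hM p)]
    have : max 0 (1 - (fderiv ℝ u x).det) ≤ 1 := by
      have := h.lo x hx
      exact max_le (by norm_num) (by linarith)
    exact Real.rpow_le_one hM this (by linarith)

theorem exists_G {n : ℕ} {U U' : Set (EE n)} {u : EE n → EE n} {lam Lam : ℝ}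
    (h : GoodSub U U' u lam Lam) (hlam : 0 < lam) (hLam : 0 < Lam) (hUb : IsBounded U) {p : ℝ} (hp : 1 ≤ p)
    {c : ℝ} (hc : 0 < c) :
    ∃ G : EE n → ℝ, Measurable G ∧ (∀ y, 0 ≤ G y) ∧ (∀ y, G y ≤ lam⁻¹ + c) ∧
      (∀ y, G y ≠ 0 → y ∈ u '' U) ∧
      (∀ x ∈ U', G (u x) = max 0 ((fderiv ℝ u x).det⁻¹ - 1) + c) ∧
      ∫ y, G y ^ p ≤ 2 ^ p * (lam ^ (1 - p) * ∫ x in U', (max 0 (1 - (fderiv ℝ u x).det)) ^ p)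
        + 2 ^ p * (Lam * c ^ p) * volume.real U := by
  classical
  have hd : ∀ x ∈ U', HasFDerivWithinAt u (fderiv ℝ u x) U' x :=
    fun x hx => (h.diff x hx).hasFDerivAt.hasFDerivWithinAt
  have hemb := measurableEmbedding_of_fderivWithin h.meas hd h.inj
  have him : MeasurableSet (u '' U') := measurable_image_of_fderivWithin h.meas hd h.inj
  set γ : EE n → ℝ := fun x => max 0 ((fderiv ℝ u x).det⁻¹ - 1) + c with hγ
  have hγm : Measurable γ :=
    (measurable_const.max ((measurable_det_fderiv u).inv.sub_const 1)).add_const c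
  obtain ⟨G', hG'm, hG'⟩ := hemb.exists_measurable_extend
    (g := fun x : U' => γ x) (hγm.comp measurable_subtype_coe) (fun _ => ⟨0⟩)
  have hG'' : ∀ x ∈ U', G' (u x) = γ x := fun x hx => congrFun hG' ⟨x, hx⟩
  have hval : ∀ x ∈ U', (u '' U').indicator G' (u x) = γ x := fun x hx => by
    rw [Set.indicator_of_mem (Set.mem_image_of_mem u hx), hG'' x hx]
  have hγ0 : ∀ x, 0 ≤ γ x := fun x => by
    have := le_max_left 0 ((fderiv ℝ u x).det⁻¹ - 1)
    simp only [hγ]; linarith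
  have hγB : ∀ x ∈ U', γ x ≤ lam⁻¹ + c := fun x hx => by
    simp only [hγ]
    have h1 : (fderiv ℝ u x).det⁻¹ ≤ lam⁻¹ := inv_anti₀ hlam (h.lo x hx)
    have h2 : 0 < lam⁻¹ := inv_pos.2 hlam
    have := max_le h2.le (by linarith : (fderiv ℝ u x).det⁻¹ - 1 ≤ lam⁻¹)
    linarith
  have hB0 : 0 ≤ lam⁻¹ + c := by have := inv_pos.2 hlam; linarith
  refine ⟨(u '' U').indicator G', hG'm.indicator him, ?_, ?_, ?_, hval, ?_⟩
  · intro y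
    by_cases hy : y ∈ u '' U'
    · obtain ⟨x, hx, rfl⟩ := hy
      rw [hval x hx]; exact hγ0 x
    · rw [Set.indicator_of_notMem hy]
  · intro y
    by_cases hy : y ∈ u '' U'
    · obtain ⟨x, hx, rfl⟩ := hy
      rw [hval x hx]; exact hγB x hx
    · rw [Set.indicator_of_notMem hy]; exact hB0
  · intro y hy
    exact Set.image_mono h.sub (Set.mem_of_indicator_ne_zero hy)
  · have hp0 : p ≠ 0 := by linarith
    have e1 : ∫ y, (u '' U').indicator G' y ^ p = ∫ y in u '' U', (u '' U').indicator G' y ^ p := by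
      symm
      apply setIntegral_eq_integral_of_forall_compl_eq_zero
      intro y hy
      rw [Set.indicator_of_notMem hy, Real.zero_rpow hp0]
    rw [e1, integral_image_eq_integral_abs_det_fderiv_smul volume h.meas hd h.inj]
    have hfin : volume U' < ⊤ := (hUb.subset h.sub).measure_lt_top
    have hEi := h.E_int hlam hUb hp
    have hci : IntegrableOn (fun _ : EE n => 2 ^ p * (Lam * c ^ p)) U' :=
      integrableOn_const hfin.ne
    calc _ ≤ ∫ x in U', (2 ^ p * (lam ^ (1 - p) * (max 0 (1 - (fderiv ℝ u x).det)) ^ p)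
          + 2 ^ p * (Lam * c ^ p)) := by
          apply integral_mono_of_nonneg
          · refine Filter.Eventually.of_forall fun x => ?_
            have : 0 ≤ (u '' U').indicator G' (u x) := by
              by_cases hy : u x ∈ u '' U'
              · obtain ⟨z, hz, hzx⟩ := hy
                rw [← hzx, hval z hz]; exact hγ0 z
              · rw [Set.indicator_of_notMem hy]
            simp only [Pi.zero_apply, smul_eq_mul]
            positivity
          · exact ((hEi.const_mul _).const_mul _).add hci
          · refine (ae_restrict_iff' h.meas).2 (Filter.Eventually.of_forall fun x hx => ?_)
            simp only [smul_eq_mul]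
            rw [hval x hx, abs_of_pos (lt_of_lt_of_le hlam (h.lo x hx))]
            exact point_bound hlam (h.lo x hx) (h.hi x hx) hc hp
      _ = 2 ^ p * (lam ^ (1 - p) * ∫ x in U', (max 0 (1 - (fderiv ℝ u x).det)) ^ p)
          + 2 ^ p * (Lam * c ^ p) * volume.real U' := by
          rw [integral_add ((hEi.const_mul _).const_mul _) hci, integral_const_mul, integral_const_mul,
            setIntegral_const, smul_eq_mul, mul_comm (volume.real U')]
      _ ≤ _ := by
          gcongr
          · exact hUb.measure_lt_top.ne
          · exact h.sub


theorem intOn_of_cont {n : ℕ} {U : Set (EE n)} (hUb : IsBounded U) {f : EE n → ℝ} (hf : Continuous f) :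
    IntegrableOn f U := by
  obtain ⟨R, hR⟩ := hUb.subset_closedBall 0
  exact (hf.continuousOn.integrableOn_compact (isCompact_closedBall (0 : EE n) R)).mono_set hR

theorem NicePair.cont {n : ℕ} {M : ℝ} {S S' : EE n → EE n} (h : NicePair M S S') : Continuous S :=
  h.1.1.continuous

theorem core_t {n : ℕ} (hn : 1 ≤ n) {p : ℝ} (hp : 1 ≤ p) {U U' : Set (EE n)} {u : EE n → EE n} {lam Lam d : ℝ}
    (hU : IsOpen U) (hUb : IsBounded U) (hu : Continuous u) (h : GoodSub U U' u lam Lam)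
    (hlam : 0 < lam) (hLam : 0 < Lam) (hP : ∀ y ∈ u '' U, ∀ w ∈ u '' U, dist y w ≤ d) (hd : 0 ≤ d)
    (hub : IsBounded (u '' U)) {t η : ℝ} (ht : 0 < t) (hη : 0 < η) :
    ∃ (S S' : EE n → EE n) (M : ℝ), NicePair M S S' ∧
      ∫ x in U, ‖u x - S x‖ ^ p ≤ 2 ^ p * (lam⁻¹ * (d + t) ^ p *
        (2 ^ p * (lam ^ (1 - p) * ∫ x in U', (max 0 (1 - (fderiv ℝ u x).det)) ^ p)
        + 2 ^ p * (Lam * t ^ p) * volume.real U + t)) + η := by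
  have hp0 : 0 ≤ p := by linarith
  obtain ⟨G, hGm, hG0, hGB, hGs, hGu, hGi⟩ := exists_G h hlam hLam hUb hp ht
  obtain ⟨R1, hR1⟩ := hUb.exists_norm_le
  obtain ⟨R2, hR2⟩ := hub.exists_norm_le
  have hli : 0 < lam⁻¹ := inv_pos.2 hlam
  set B := lam⁻¹ + t with hB
  have hB0 : 0 < B := by positivity
  set R := 1 + |R1| + |R2| + (d + t) * B with hR
  have hdtB : 0 ≤ (d + t) * B := by positivity
  have hRR : 1 ≤ R := by have := abs_nonneg R1; have := abs_nonneg R2; linarith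
  have hm1 : 1 < 1 + t * lam / 2 := by have : 0 < t * lam / 2 := by positivity
                                       linarith
  have hm0 : 0 < 1 + t * lam / 2 := by linarith
  set θ := 1 - (1 + t * lam / 2)⁻¹ with hθ
  have hθ0 : 0 < θ := by have := inv_lt_one_of_one_lt₀ hm1; simp only [hθ]; linarith
  have hθ1 : θ < 1 := by have := inv_pos.2 hm0; simp only [hθ]; linarith
  have h2p : (0:ℝ) < 2 ^ p := Real.rpow_pos_of_pos (by norm_num) p
  set η' := η / (2 * 2 ^ p) with hη'
  have hη'0 : 0 < η' := by positivity
  set Q := ((2 + 14 * n) * R) ^ p * (θ⁻¹ * lam⁻¹) with hQ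
  have hQ0 : 0 < Q := by positivity
  set ε := min t (η' / Q) with hε
  have hε0 : 0 < ε := lt_min ht (by positivity)
  obtain ⟨g, hg1, hgc, hg0, hgB, hgs, hgi, hgv⟩ :=
    mollify (κ := t / 2) hGm hG0 hGB hub hGs hp ht hε0 (by positivity)
  set e : EE n := EuclideanSpace.single (Sum.inl ⟨0, hn⟩) 1 with he
  have he1 : ‖e‖ = 1 := by simp [he]
  have hTc : ContDiff ℝ 1 (rayInt e g) := rayInt_contDiff he1 hg1 hgc
  set F : EE n → EE n := fun x => Tmap e g (u x) with hF
  have hFc : Continuous F := by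
    have : Continuous (Tmap e g) := by
      unfold Tmap
      exact continuous_id.add (hTc.continuous.smul continuous_const)
    exact this.comp hu
  set bad : Set (EE n) := {y | g y < G y - t / 2} with hbad
  have hbadm : MeasurableSet bad :=
    measurableSet_lt hg1.continuous.measurable (hGm.sub_const _)
  set V := U' \ u ⁻¹' bad with hV
  have hVm : MeasurableSet V := h.meas.diff (hu.measurable hbadm)
  have hVU' : V ⊆ U' := Set.sdiff_subset
  have hVU : V ⊆ U := hVU'.trans h.sub
  have hvolV : volume.real (U \ V) ≤ lam⁻¹ * ε := by
    have h1 : volume (U ∩ u ⁻¹' bad) ≤ ENNReal.ofReal lam⁻¹ * ENNReal.ofReal ε := by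
      have hh := h.push hlam (bad.indicator 1)
      rw [lintegral_indicator_one hbadm] at hh
      have e1 : ∫⁻ x in U, bad.indicator 1 (u x) = volume (U ∩ u ⁻¹' bad) := by
        have : (fun x => bad.indicator (1 : EE n → ENNReal) (u x)) = (u ⁻¹' bad).indicator 1 := by
          ext x; simp [Set.indicator]
        rw [this, lintegral_indicator_one (hu.measurable hbadm),
          Measure.restrict_apply (hu.measurable hbadm), Set.inter_comm]
      rw [e1] at hh
      exact hh.trans (by gcongr)
    have h2 : volume (U \ V) ≤ ENNReal.ofReal (lam⁻¹ * ε) := by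
      rw [ENNReal.ofReal_mul hli.le]
      calc volume (U \ V) ≤ volume ((U \ U') ∪ (U ∩ u ⁻¹' bad)) := by
            apply measure_mono
            intro x hx
            by_cases hxU : x ∈ U'
            · right
              refine ⟨hx.1, ?_⟩
              by_contra hb
              exact hx.2 ⟨hxU, hb⟩
            · left; exact ⟨hx.1, hxU⟩
        _ ≤ volume (U \ U') + volume (U ∩ u ⁻¹' bad) := measure_union_le _ _
        _ ≤ _ := by rw [h.full, zero_add]; exact h1
    exact ENNReal.toReal_le_of_le_ofReal (by positivity) h2
  have hFd : ∀ x ∈ U', DifferentiableAt ℝ F x ∧ (fderiv ℝ F x).det = (1 + g (u x)) * (fderiv ℝ u x).det := by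
    intro x hx
    obtain ⟨L, hL, hLd⟩ := Tmap_hasFDerivAt he1 hg1 hgc (u x)
    have hc := hL.comp x (h.diff x hx).hasFDerivAt
    refine ⟨hc.differentiableAt, ?_⟩
    have : fderiv ℝ F x = L.comp (fderiv ℝ u x) := hc.fderiv
    rw [this, ← hLd]
    exact LinearMap.det_comp _ _
  have hpush : ∀ A, MeasurableSet A → volume A ≠ ⊤ →
      volume.real (V ∩ F ⁻¹' A) ≤ (1 - θ) * volume.real A := by
    intro A hA hAf
    have e1 : 1 - θ = (1 + t * lam / 2)⁻¹ := by simp only [hθ]; ring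
    rw [e1]
    refine push_bound hVm hFc.measurable (fun x hx => (hFd x (hVU' hx)).1) ?_ hm0 ?_ hA hAf
    · intro x hx y hy hxy
      exact h.inj (hVU' hx) (hVU' hy) (Tmap_injective he1 hg1.continuous hgc hg0 hxy)
    · intro x hx
      rw [(hFd x (hVU' hx)).2]
      have hb : ¬ (g (u x) < G (u x) - t / 2) := hx.2
      rw [hGu x (hVU' hx)] at hb
      push Not at hb
      have ha := h.lo x (hVU' hx)
      set a := (fderiv ℝ u x).det
      have ha0 : 0 < a := lt_of_lt_of_le hlam ha
      have h3 : a⁻¹ - 1 ≤ max 0 (a⁻¹ - 1) := le_max_right _ _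
      have h4 : a⁻¹ + t / 2 ≤ 1 + g (u x) := by linarith
      calc 1 + t * lam / 2 ≤ 1 + t * a / 2 := by gcongr
        _ = (a⁻¹ + t / 2) * a := by field_simp
        _ ≤ _ := by gcongr
  have hray : ∀ x, ‖u x - F x‖ = rayInt e g (u x) := by
    intro x
    simp only [hF, Tmap]
    rw [sub_add_cancel_left, norm_neg, norm_smul, he1, mul_one, Real.norm_eq_abs,
      abs_of_nonneg (rayInt_nonneg hg0 _)]
  have hUR : ∀ x ∈ U, ‖x‖ ≤ R := fun x hx => by
    have := hR1 x hx; have := le_abs_self R1; have := abs_nonneg R2; linarith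
  have hFR : ∀ x ∈ U, ‖F x‖ ≤ R := fun x hx => by
    have h1 := rayInt_le he1 hP (by positivity) hgs hg0 hgB (Set.mem_image_of_mem u hx)
    have h2 := hR2 _ (Set.mem_image_of_mem u hx)
    have h3 : ‖F x‖ ≤ ‖u x‖ + ‖u x - F x‖ := by
      have := norm_sub_le (u x) (u x - F x)
      simpa using this
    rw [hray] at h3
    have := le_abs_self R2; have := abs_nonneg R1; linarith
  obtain ⟨S, S', M, hS, hSi⟩ := approx hn hp hU hVm hVU hFc hRR hUR hFR hθ0 hθ1 hpush hη'0
  refine ⟨S, S', M, hS, ?_⟩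
  have hcost := cost_le (κ := lam⁻¹) he1 hg1 hgc hU.measurableSet hu.measurable hP (by positivity)
    hgs hg0 hp hli.le (fun H _ => h.push hlam H)
  have hSc := hS.cont
  have i1 : IntegrableOn (fun x => ‖u x - F x‖ ^ p) U :=
    intOn_of_cont hUb ((hu.sub hFc).norm.rpow_const fun _ => Or.inr hp0)
  have i2 : IntegrableOn (fun x => ‖F x - S x‖ ^ p) U :=
    intOn_of_cont hUb ((hFc.sub hSc).norm.rpow_const fun _ => Or.inr hp0)
  have i3 : IntegrableOn (fun x => ‖u x - S x‖ ^ p) U :=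
    intOn_of_cont hUb ((hu.sub hSc).norm.rpow_const fun _ => Or.inr hp0)
  have hsplit : ∫ x in U, ‖u x - S x‖ ^ p ≤ 2 ^ p * ((∫ x in U, ‖u x - F x‖ ^ p) + ∫ x in U, ‖F x - S x‖ ^ p) := by
    rw [← integral_add i1 i2, ← integral_const_mul]
    refine integral_mono i3 ((i1.add i2).const_mul _) fun x => ?_
    refine le_trans ?_ (add_rpow_le_two (norm_nonneg _) (norm_nonneg _) hp)
    exact Real.rpow_le_rpow (norm_nonneg _) (norm_sub_le_norm_sub_add_norm_sub _ _ _) hp0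
  have hb2 : ∫ x in U, ‖F x - S x‖ ^ p ≤ 2 * η' := by
    refine hSi.trans ?_
    have : ((2 + 14 * n) * R) ^ p * (θ⁻¹ * volume.real (U \ V)) ≤ Q * ε := by
      simp only [hQ]
      rw [mul_assoc, mul_assoc]
      gcongr
    have h2 : Q * ε ≤ η' := by
      calc Q * ε ≤ Q * (η' / Q) := by gcongr; exact min_le_right _ _
        _ = η' := by field_simp
    linarith
  have hb1 : ∫ x in U, ‖u x - F x‖ ^ p ≤ lam⁻¹ * (d + t) ^ p *
        (2 ^ p * (lam ^ (1 - p) * ∫ x in U', (max 0 (1 - (fderiv ℝ u x).det)) ^ p)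
        + 2 ^ p * (Lam * t ^ p) * volume.real U + t) := by
    simp only [hray]
    refine hcost.trans ?_
    gcongr
    refine hgi.trans (add_le_add hGi (min_le_left _ _))
  have hfin : 2 ^ p * (2 * η') = η := by simp only [hη']; field_simp
  calc _ ≤ _ := hsplit
    _ ≤ 2 ^ p * (_ + 2 * η') := mul_le_mul_of_nonneg_left (add_le_add hb1 hb2) h2p.le
    _ = _ := by rw [mul_add, hfin]

theorem core {n : ℕ} (hn : 1 ≤ n) {p : ℝ} (hp : 1 ≤ p) {U U' : Set (EE n)} {u : EE n → EE n} {lam Lam d : ℝ}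
    (hU : IsOpen U) (hUb : IsBounded U) (hu : Continuous u) (h : GoodSub U U' u lam Lam)
    (hlam : 0 < lam) (hLam : 0 < Lam) (hP : ∀ y ∈ u '' U, ∀ w ∈ u '' U, dist y w ≤ d) (hd : 0 ≤ d)
    (hub : IsBounded (u '' U)) {ε : ℝ} (hε : 0 < ε) :
    ∃ (S S' : EE n → EE n) (M : ℝ), NicePair M S S' ∧
      ∫ x in U, ‖u x - S x‖ ^ p ≤ 2 ^ p * (2 ^ p * (d ^ p * lam ^ (-p))) *
        (∫ x in U', (max 0 (1 - (fderiv ℝ u x).det)) ^ p) + ε := by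
  have hp0 : 0 ≤ p := by linarith
  have hpp : 0 < p := by linarith
  set E := ∫ x in U', (max 0 (1 - (fderiv ℝ u x).det)) ^ p with hE
  set f : ℝ → ℝ := fun t => 2 ^ p * (lam⁻¹ * (d + t) ^ p * (2 ^ p * (lam ^ (1 - p) * E)
        + 2 ^ p * (Lam * t ^ p) * volume.real U + t)) with hf
  have hfc : Continuous f := by
    have h1 : Continuous fun t : ℝ => (d + t) ^ p :=
      (continuous_const.add continuous_id).rpow_const fun _ => Or.inr hp0
    have h2 : Continuous fun t : ℝ => t ^ p := continuous_id.rpow_const fun _ => Or.inr hp0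
    simp only [hf]
    fun_prop
  have hf0 : f 0 = 2 ^ p * (2 ^ p * (d ^ p * lam ^ (-p))) * E := by
    simp only [hf]
    rw [Real.zero_rpow hpp.ne']
    have : lam ^ (-p) = lam⁻¹ * lam ^ (1 - p) := by
      rw [sub_eq_add_neg, Real.rpow_add hlam, Real.rpow_one, ← mul_assoc, inv_mul_cancel₀ hlam.ne', one_mul]
    rw [this]
    simp only [add_zero, mul_zero, zero_mul]
    ring
  have hev : ∀ᶠ t in nhds (0:ℝ), f t < f 0 + ε / 2 :=
    hfc.continuousAt.eventually (gt_mem_nhds (by linarith))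
  obtain ⟨δ, hδ, hball⟩ := Metric.eventually_nhds_iff.1 hev
  have ht := hball (y := δ / 2) (by rw [Real.dist_eq, sub_zero, abs_of_pos (by linarith)]; linarith)
  obtain ⟨S, S', M, hS, hi⟩ := core_t hn hp hU hUb hu h hlam hLam hP hd hub
    (t := δ / 2) (η := ε / 2) (by linarith) (by linarith)
  refine ⟨S, S', M, hS, ?_⟩
  rw [hf0] at ht
  have : ∫ x in U, ‖u x - S x‖ ^ p ≤ f (δ / 2) + ε / 2 := hi
  linarith


theorem lipOn_ball {E F : Type*} [NormedAddCommGroup E] [NormedSpace ℝ E] [ProperSpace E]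
    [NormedAddCommGroup F] [NormedSpace ℝ F] {f : E → F} (hf : ContDiff ℝ 1 f) (R : ℝ) :
    ∃ K : NNReal, LipschitzOnWith K f (closedBall 0 R) :=
  LocallyLipschitzOn.exists_lipschitzOnWith_of_compact (isCompact_closedBall 0 R)
    (hf.locallyLipschitz.locallyLipschitzOn)

theorem frob_nonneg {ι : Type*} [Fintype ι] (A : Matrix ι ι ℝ) : 0 ≤ frob A := Real.sqrt_nonneg _

theorem frob_eq_zero {ι : Type*} [Fintype ι] {A : Matrix ι ι ℝ} (h : frob A = 0) : A = 0 := by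
  have h1 : 0 ≤ ∑ i, ∑ j, (A i j) ^ 2 := Finset.sum_nonneg fun i _ => Finset.sum_nonneg fun j _ => sq_nonneg _
  have h2 := (Real.sqrt_eq_zero h1).1 h
  ext i j
  have h3 := (Finset.sum_eq_zero_iff_of_nonneg
    (fun i _ => Finset.sum_nonneg fun j _ => sq_nonneg (A i j))).1 h2 i (Finset.mem_univ _)
  have h4 := (Finset.sum_eq_zero_iff_of_nonneg (fun j _ => sq_nonneg (A i j))).1 h3 j (Finset.mem_univ _)
  simpa using h4

theorem det_lip (n : ℕ) : ∃ C : ℝ, 1 ≤ C ∧ ∀ A : Matrix (Fin n ⊕ Fin n) (Fin n ⊕ Fin n) ℝ, 0 < A.det →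
    max 0 (1 - A.det) ≤ C * frob (Aᵀ * Matrix.J (Fin n) ℝ * A - Matrix.J (Fin n) ℝ) := by
  classical
  set J := Matrix.J (Fin n) ℝ with hJ
  set toM : EuclideanSpace ℝ ((Fin n ⊕ Fin n) × (Fin n ⊕ Fin n)) → Matrix (Fin n ⊕ Fin n) (Fin n ⊕ Fin n) ℝ := fun v => Matrix.of fun i j => v (i, j) with htoM
  have hc : ContDiff ℝ 1 fun v : EuclideanSpace ℝ ((Fin n ⊕ Fin n) × (Fin n ⊕ Fin n)) => (J + toM v).det := by
    simp only [Matrix.det_apply, htoM, Matrix.add_apply, Matrix.of_apply]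
    refine ContDiff.sum fun σ _ => ContDiff.const_smul _ (contDiff_prod fun i _ => ?_)
    fun_prop
  obtain ⟨K, hK⟩ := lipOn_ball hc 1
  refine ⟨K + 1, by have := K.coe_nonneg; linarith, fun A hA => ?_⟩
  set X := Aᵀ * J * A - J with hX
  have hK0 := K.coe_nonneg
  have hf0 := frob_nonneg X
  refine max_le (by positivity) ?_
  by_cases ha : 1 ≤ A.det
  · have : 0 ≤ ((K:ℝ) + 1) * frob X := by positivity
    linarith
  push Not at ha
  by_cases hb : 1 ≤ frob X
  · nlinarith
  push Not at hb
  set v : EuclideanSpace ℝ ((Fin n ⊕ Fin n) × (Fin n ⊕ Fin n)) := WithLp.toLp 2 fun ij => X ij.1 ij.2 with hv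
  have hvn : ‖v‖ = frob X := by
    rw [EuclideanSpace.norm_eq, Fintype.sum_prod_type]
    simp only [frob, hv, Real.norm_eq_abs, sq_abs]
  have h1 := hK.dist_le_mul 0 (by simp) v (by simpa [hvn] using hb.le)
  have e1 : toM v = X := by ext i j; simp [htoM, hv]
  have e0 : toM 0 = 0 := by ext i j; simp [htoM]
  rw [dist_zero_left, hvn, Real.dist_eq, e1, e0, add_zero] at h1
  have e2 : J + X = Aᵀ * J * A := by rw [hX]; abel
  rw [e2, Matrix.det_mul, Matrix.det_mul, Matrix.det_transpose] at h1
  have hJJ : J.det * J.det = 1 := Matrix.J_det_mul_J_det (Fin n) ℝ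
  have hJa : |J.det| = 1 := by
    have : |J.det| * |J.det| = 1 := by rw [← abs_mul, hJJ, abs_one]
    nlinarith [abs_nonneg J.det]
  have e3 : J.det - A.det * J.det * A.det = J.det * (1 - A.det ^ 2) := by ring
  rw [e3, abs_mul, hJa, one_mul] at h1
  have h2 := le_abs_self (1 - A.det ^ 2)
  nlinarith

theorem matD_apply {n : ℕ} (u : EE n → EE n) (x : EE n) (i j) :
    matD u x i j = (fderiv ℝ u x (EuclideanSpace.single j 1)) i := by
  simp [matD, LinearMap.toMatrix_apply]

/-- the energy density as a function of the derivative -/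
def enD {n : ℕ} (p : ℝ) (L : EE n →L[ℝ] EE n) : ℝ :=
  frob ((Matrix.of fun i j => (L (EuclideanSpace.single j 1)) i)ᵀ * Matrix.J (Fin n) ℝ *
    (Matrix.of fun i j => (L (EuclideanSpace.single j 1)) i) - Matrix.J (Fin n) ℝ) ^ p

theorem enD_eq {n : ℕ} (p : ℝ) (u : EE n → EE n) (x : EE n) :
    frob ((matD u x)ᵀ * Matrix.J (Fin n) ℝ * matD u x - Matrix.J (Fin n) ℝ) ^ p = enD p (fderiv ℝ u x) := by
  have : matD u x = Matrix.of fun i j => (fderiv ℝ u x (EuclideanSpace.single j 1)) i := by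
    ext i j; rw [matD_apply]; rfl
  rw [this, enD]

theorem enD_cont {n : ℕ} {p : ℝ} (hp : 0 ≤ p) : Continuous (enD (n := n) p) := by
  unfold enD frob
  refine Continuous.rpow_const ?_ fun _ => Or.inr hp
  refine Real.continuous_sqrt.comp (continuous_finsetSum _ fun i _ => continuous_finsetSum _ fun j _ => ?_)
  simp only [Matrix.sub_apply, Matrix.mul_apply, Matrix.transpose_apply, Matrix.of_apply]
  fun_prop

theorem en_int {n : ℕ} {p : ℝ} (hp : 0 ≤ p) {U : Set (EE n)} (hUb : IsBounded U) {u : EE n → EE n} {K : NNReal}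
    (hu : LipschitzWith K u) : IntegrableOn (fun x => enD p (fderiv ℝ u x)) U := by
  obtain ⟨C, hC⟩ := ((isCompact_closedBall (0 : EE n →L[ℝ] EE n) K).image (enD_cont hp)).isBounded.exists_norm_le
  refine Measure.integrableOn_of_bounded (M := C) hUb.measure_lt_top.ne ?_ ?_
  · exact ((enD_cont hp).measurable.comp (measurable_fderiv ℝ u)).aestronglyMeasurable
  · refine Filter.Eventually.of_forall fun x => hC _ ⟨_, ?_, rfl⟩
    simpa using norm_fderiv_le_of_lipschitz ℝ hu

theorem multOn_nice {n : ℕ} {M : ℝ} {S S' : EE n → EE n} (h : NicePair M S S') {U : Set (EE n)} (hU : IsOpen U)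
    (hne : U.Nonempty) : multOn U S = 1 := by
  have hinj : Function.Injective S := Function.LeftInverse.injective h.2.2.1
  apply le_antisymm
  · refine essSup_le_of_ae_le _ (Filter.Eventually.of_forall fun y => ?_)
    refine Set.encard_le_one_iff.2 fun a b ha hb => hinj ?_
    exact ha.2.trans hb.2.symm
  · by_contra hlt
    push Not at hlt
    have h0 : multOn U S = 0 := Order.lt_one_iff.1 hlt
    have hae := ae_le_essSup (f := fun y : EE n => (U ∩ S ⁻¹' {y}).encard) (μ := volume)
    rw [← multOn.eq_1, h0] at hae
    have hop : IsOpen (S' ⁻¹' U) := hU.preimage h.2.1.1.continuous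
    obtain ⟨x, hx⟩ := hne
    have hpos : 0 < volume (S' ⁻¹' U) := hop.measure_pos _ ⟨S x, by simpa [h.2.2.1 x] using hx⟩
    have hz : volume (S' ⁻¹' U) = 0 := by
      refine measure_mono_null ?_ hae
      intro y hy hcon
      have hcon' : (U ∩ S ⁻¹' {y}).encard ≤ 0 := hcon
      have h3 := Set.encard_eq_zero.1 (le_antisymm hcon' bot_le)
      have : S' y ∈ U ∩ S ⁻¹' {y} := ⟨hy, h.2.2.2.1 y⟩
      rw [h3] at this
      exact this
    exact hpos.ne' hz

theorem weight_bound {n : ℕ} {p d lam Lam : ℝ} (hp : 1 ≤ p) (hd : 0 ≤ d) (hlam : 0 < lam) (hLL : lam ≤ Lam) :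
    1 ≤ (1 + (1 + Lam) ^ (2 * n - 1) * (d / lam ^ ((n : ℝ))⁻¹) ^ p *
                (1 + (lam ^ p)⁻¹ * (Lam / lam) ^ (2 * p - 2))) ∧
    (lam ≤ 1 → d ^ p * lam ^ (-p) ≤ (1 + (1 + Lam) ^ (2 * n - 1) * (d / lam ^ ((n : ℝ))⁻¹) ^ p *
                (1 + (lam ^ p)⁻¹ * (Lam / lam) ^ (2 * p - 2)))) := by
  have hLam : 0 < Lam := by linarith
  have h0 : 0 ≤ (1 + Lam) ^ (2 * n - 1) * (d / lam ^ ((n : ℝ))⁻¹) ^ p *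
                (1 + (lam ^ p)⁻¹ * (Lam / lam) ^ (2 * p - 2)) := by positivity
  refine ⟨by linarith, fun h1 => ?_⟩
  have a1 : (1:ℝ) ≤ (1 + Lam) ^ (2 * n - 1) := one_le_pow₀ (by linarith)
  have a2 : d ^ p ≤ (d / lam ^ ((n : ℝ))⁻¹) ^ p := by
    refine Real.rpow_le_rpow hd ?_ (by linarith)
    have hl : 0 < lam ^ ((n : ℝ))⁻¹ := Real.rpow_pos_of_pos hlam _
    rw [le_div_iff₀ hl]
    have : lam ^ ((n : ℝ))⁻¹ ≤ 1 := Real.rpow_le_one hlam.le h1 (by positivity)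
    nlinarith
  have a3 : (1:ℝ) ≤ (Lam / lam) ^ (2 * p - 2) :=
    Real.one_le_rpow ((one_le_div hlam).2 hLL) (by linarith)
  have hlp : 0 < (lam ^ p)⁻¹ := by positivity
  have a4 : lam ^ (-p) ≤ 1 + (lam ^ p)⁻¹ * (Lam / lam) ^ (2 * p - 2) := by
    rw [Real.rpow_neg hlam.le]
    nlinarith
  have : 1 * d ^ p * lam ^ (-p) ≤ (1 + Lam) ^ (2 * n - 1) * (d / lam ^ ((n : ℝ))⁻¹) ^ p *
                (1 + (lam ^ p)⁻¹ * (Lam / lam) ^ (2 * p - 2)) := by gcongr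
  linarith

theorem stmt_17 (n : ℕ) (hn : 1 ≤ n) (p : ℝ) (hp : 1 ≤ p) :
    ∃ C₇ : ℝ, 0 < C₇ ∧
      ∀ (U : Set (EuclideanSpace ℝ (Fin n ⊕ Fin n))), U.Nonempty → IsOpen U →
        IsBounded U → IsConnected U →
      ∀ (u : EuclideanSpace ℝ (Fin n ⊕ Fin n) → EuclideanSpace ℝ (Fin n ⊕ Fin n)) (K : NNReal),
        LipschitzOnWith K u U → IsBounded (u '' U) →
        multOn U u = 1 →
      ∀ (d lam Lam : ℝ),
        diam (u '' U) ≤ d →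
        0 < lam →
        (∀ᵐ x ∂(volume.restrict U), DifferentiableAt ℝ u x ∧
            lam ≤ (matD u x).det ∧ (matD u x).det ≤ Lam) →
        ∃ (S : EuclideanSpace ℝ (Fin n ⊕ Fin n) → EuclideanSpace ℝ (Fin n ⊕ Fin n)) (Ks : NNReal),
          LipschitzOnWith Ks S U ∧ IsBounded (S '' U) ∧
          multOn U S = 1 ∧
          (∀ᵐ x ∂(volume.restrict U), DifferentiableAt ℝ S x ∧
            (matD S x)ᵀ * Matrix.J (Fin n) ℝ * matD S x = Matrix.J (Fin n) ℝ) ∧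
          (∫ x in U, ‖u x - S x‖ ^ p)
            ≤ C₇ * (1 + (1 + Lam) ^ (2 * n - 1) * (d / lam ^ ((n : ℝ))⁻¹) ^ p *
                (1 + (lam ^ p)⁻¹ * (Lam / lam) ^ (2 * p - 2))) *
              ∫ x in U, frob ((matD u x)ᵀ * Matrix.J (Fin n) ℝ * matD u x - Matrix.J (Fin n) ℝ) ^ p := by
  obtain ⟨C, hC1, hC⟩ := det_lip n
  have hp0 : 0 ≤ p := by linarith
  have hpp : p ≠ 0 := by linarith
  have hC0 : 0 ≤ C := by linarith
  have h2p : (0:ℝ) < 2 ^ p := Real.rpow_pos_of_pos (by norm_num) p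
  have hCp : 0 < C ^ p := Real.rpow_pos_of_pos (by linarith) p
  refine ⟨2 ^ p * 2 ^ p * C ^ p + 1, by positivity, ?_⟩
  intro U hne hU hUb _ u K hK hub hm d lam Lam hdd hlam hdet
  have hd : 0 ≤ d := diam_nonneg.trans hdd
  obtain ⟨v, hv, huv⟩ := hK.extend_finite_dimension
  have hloc : ∀ x ∈ U, u =ᶠ[nhds x] v := fun x hx =>
    Filter.eventuallyEq_of_mem (hU.mem_nhds hx) huv
  have hfd : ∀ x ∈ U, fderiv ℝ u x = fderiv ℝ v x := fun x hx => (hloc x hx).fderiv_eq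
  have himg : v '' U = u '' U := (huv.image_eq).symm
  have hmv : multOn U v = 1 := by
    rw [← hm]
    unfold multOn
    congr 1
    ext1 y
    congr 1
    ext x
    simp only [Set.mem_inter_iff, Set.mem_preimage, Set.mem_singleton_iff]
    exact and_congr_right fun hx => by rw [huv hx]
  have hdet' : ∀ᵐ x ∂(volume.restrict U), DifferentiableAt ℝ v x ∧
      lam ≤ (fderiv ℝ v x).det ∧ (fderiv ℝ v x).det ≤ Lam := by
    filter_upwards [hdet, ae_restrict_mem hU.measurableSet] with x hx hxU
    rw [matD_det, hfd x hxU] at hx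
    exact ⟨(hloc x hxU).differentiableAt_iff.1 hx.1, hx.2⟩
  have hvolU : 0 < volume U := hU.measure_pos _ hne
  have hLL : lam ≤ Lam := by
    have : (ae (volume.restrict U)).NeBot := by
      rw [ae_neBot]
      intro h0
      rw [Measure.restrict_eq_zero] at h0
      exact hvolU.ne' h0
    obtain ⟨x, hx⟩ := hdet.exists
    exact hx.2.1.trans hx.2.2
  have hLam : 0 < Lam := by linarith
  obtain ⟨U', hg⟩ := exists_goodSub hU hv.continuous hmv hlam hdet'
  obtain ⟨hW1, hW2⟩ := weight_bound (n := n) hp hd hlam hLL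
  set W := (1 + (1 + Lam) ^ (2 * n - 1) * (d / lam ^ ((n : ℝ))⁻¹) ^ p *
                (1 + (lam ^ p)⁻¹ * (Lam / lam) ^ (2 * p - 2))) with hW
  have heq : ∫ x in U, frob ((matD u x)ᵀ * Matrix.J (Fin n) ℝ * matD u x - Matrix.J (Fin n) ℝ) ^ p
      = ∫ x in U, enD p (fderiv ℝ v x) := by
    refine setIntegral_congr_fun hU.measurableSet fun x hx => ?_
    simp only [enD_eq, hfd x hx]
  rw [heq]
  have hEnInt := en_int hp0 hUb hv
  have hen0 : ∀ L : EE n →L[ℝ] EE n, 0 ≤ enD p L := fun L => Real.rpow_nonneg (frob_nonneg _) _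
  set I := ∫ x in U, enD p (fderiv ℝ v x) with hI
  have hI0 : 0 ≤ I := integral_nonneg fun x => hen0 _
  rcases hI0.eq_or_lt with hI0 | hIpos
  · refine ⟨u, K, hK, hub, hm, ?_, ?_⟩
    · have hz := (setIntegral_eq_zero_iff_of_nonneg_ae (Filter.Eventually.of_forall fun x => hen0 _) hEnInt).1 hI0.symm
      filter_upwards [hdet, hz, ae_restrict_mem hU.measurableSet] with x hx hzx hxU
      refine ⟨hx.1, ?_⟩
      simp only [Pi.zero_apply] at hzx
      rw [← hfd x hxU, ← enD_eq, Real.rpow_eq_zero (frob_nonneg _) hpp] at hzx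
      exact sub_eq_zero.1 (frob_eq_zero hzx)
    · simp [Real.zero_rpow hpp, ← hI0]
  have hP : ∀ y ∈ v '' U, ∀ w ∈ v '' U, dist y w ≤ d := by
    rw [himg]
    intro y hy w hw
    exact (dist_le_diam_of_mem hub hy hw).trans hdd
  obtain ⟨S, S', M, hS, hSi⟩ := core hn hp hU hUb hv.continuous hg hlam hLam hP hd (by rw [himg]; exact hub) hIpos
  obtain ⟨R, hR⟩ := hUb.subset_closedBall 0
  obtain ⟨Ks, hKs⟩ := lipOn_ball hS.1.1 R
  refine ⟨S, Ks, hKs.mono hR, ?_, multOn_nice hS hU hne, ?_, ?_⟩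
  · exact ((isCompact_closedBall (0 : EE n) R).image hS.cont).isBounded.subset (Set.image_mono hR)
  · exact Filter.Eventually.of_forall fun x => ⟨(hS.1.1.differentiable one_ne_zero).differentiableAt, hS.1.2 x⟩
  have heq2 : ∫ x in U, ‖u x - S x‖ ^ p = ∫ x in U, ‖v x - S x‖ ^ p := by
    refine setIntegral_congr_fun hU.measurableSet fun x hx => ?_
    simp only [huv hx]
  rw [heq2]
  refine hSi.trans ?_
  set E := ∫ x in U', (max 0 (1 - (fderiv ℝ v x).det)) ^ p with hE
  have hpt : ∀ x ∈ U', (max 0 (1 - (fderiv ℝ v x).det)) ^ p ≤ C ^ p * enD p (fderiv ℝ v x) := by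
    intro x hx
    rw [← enD_eq, ← matD_det, ← Real.mul_rpow hC0 (frob_nonneg _)]
    refine Real.rpow_le_rpow (le_max_left _ _) (hC _ ?_) hp0
    rw [matD_det]
    exact lt_of_lt_of_le hlam (hg.lo x hx)
  have hEI : E ≤ C ^ p * I := by
    calc E ≤ ∫ x in U', C ^ p * enD p (fderiv ℝ v x) :=
          setIntegral_mono_on (hg.E_int hlam hUb hp) ((hEnInt.mono_set hg.sub).const_mul _) hg.meas hpt
      _ = C ^ p * ∫ x in U', enD p (fderiv ℝ v x) := by rw [integral_const_mul]
      _ ≤ C ^ p * I := by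
          refine mul_le_mul_of_nonneg_left ?_ hCp.le
          exact setIntegral_mono_set hEnInt (Filter.Eventually.of_forall fun x => hen0 _)
            (Filter.Eventually.of_forall hg.sub)
  have hmain : d ^ p * lam ^ (-p) * E ≤ W * (C ^ p * I) := by
    by_cases hl1 : lam ≤ 1
    · have hw0 : 0 ≤ d ^ p * lam ^ (-p) := by positivity
      exact mul_le_mul (hW2 hl1) hEI (integral_nonneg fun x => Real.rpow_nonneg (le_max_left _ _) _) (by linarith)
    · push Not at hl1
      have hE0 : E = 0 := by
        rw [hE]
        refine setIntegral_eq_zero_of_forall_eq_zero fun x hx => ?_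
        have := hg.lo x hx
        rw [max_eq_left (by linarith), Real.zero_rpow hpp]
      rw [hE0, mul_zero]
      positivity
  have hWI : I ≤ W * I := by nlinarith
  calc 2 ^ p * (2 ^ p * (d ^ p * lam ^ (-p))) * E + I
      = 2 ^ p * 2 ^ p * (d ^ p * lam ^ (-p) * E) + I := by ring
    _ ≤ 2 ^ p * 2 ^ p * (W * (C ^ p * I)) + W * I := by gcongr
    _ = _ := by ring

end
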